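/- arXiv:1101.1462 — 2 statements merged into one kernel-verified Lean document; each statement's English description precedes it below -/
import Mathlib

section
/- Suppose 0 < k ≤ q and 0 ≤ β < kn/q. Then the infimum S_Ω(β,k) is attained in the following sense: there exist a nonnegative function u ∈ L^q(Ω) with ∫_Ω u^q dx = 1, a vector field g ∈ L²(Ω;ℝⁿ), and a sequence (φ_j) ⊂ C_c^∞(Ω) such that φ_j → u in L^q(Ω), ∇φ_j → g in L²(Ω;ℝⁿ), and ∫_Ω (1 + |x|^β u(x)^k)|g(x)|² dx = S_Ω(β,k). -/
open MeasureTheory Filter Topology Set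

noncomputable section

def smoothCpt (n : ℕ) (Ω : Set (EuclideanSpace ℝ (Fin n)))
    (u : EuclideanSpace ℝ (Fin n) → ℝ) : Prop :=
  ContDiff ℝ (⊤ : ℕ∞) u ∧ HasCompactSupport u ∧ tsupport u ⊆ Ω

/-- The weighted energy `I_{Ω;β,k}(u) = ∫_Ω (1+|x|^β |u|^k) |∇u|²`. -/
def energy (n : ℕ) (Ω : Set (EuclideanSpace ℝ (Fin n))) (β k : ℝ)
    (u : EuclideanSpace ℝ (Fin n) → ℝ) : ℝ :=
  ∫ x in Ω, (1 + ‖x‖ ^ β * |u x| ^ k) * ‖gradient u x‖ ^ 2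

/-- `S_Ω(β,k)`: infimum of the weighted energy over `C_c^∞(Ω)` functions normalized in `L^q`. -/
def Sw (n : ℕ) (Ω : Set (EuclideanSpace ℝ (Fin n))) (β k q : ℝ) : ℝ :=
  sInf {c | ∃ u, smoothCpt n Ω u ∧ (∫ x in Ω, |u x| ^ q) = 1 ∧ c = energy n Ω β k u}

/-- The best Sobolev constant `S`. -/
def Sbest (n : ℕ) (Ω : Set (EuclideanSpace ℝ (Fin n))) (q : ℝ) : ℝ :=
  sInf {c | ∃ u, smoothCpt n Ω u ∧ (∫ x in Ω, |u x| ^ q) = 1 ∧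
    c = ∫ x in Ω, ‖gradient u x‖ ^ 2}

theorem exists_tendsto_linearCombination_convexHull {H : Type*} [NormedAddCommGroup H]
    [InnerProductSpace ℝ H] [CompleteSpace H] (x : ℕ → H) (C : ℝ) (hx : ∀ j, ‖x j‖ ≤ C) :
    ∃ c : ℕ → (ℕ →₀ ℝ),
      (∀ m, c m ∈ convexHull ℝ ((fun j => Finsupp.single j (1 : ℝ)) '' Ici m)) ∧
      ∃ y, Tendsto (fun m => Finsupp.linearCombination ℝ x (c m)) atTop (𝓝 y) := by
  set K : ℕ → Set (ℕ →₀ ℝ) := fun m => convexHull ℝ ((fun j => Finsupp.single j (1 : ℝ)) '' Ici m)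
  set L := Finsupp.linearCombination ℝ x
  have hKne : ∀ m, (K m).Nonempty := fun m =>
    ⟨_, subset_convexHull ℝ _ ⟨m, self_mem_Ici, rfl⟩⟩
  have hKanti : ∀ {m l}, m ≤ l → K l ⊆ K m := fun h =>
    convexHull_mono (image_mono (Ici_subset_Ici.2 h))
  have hC : 0 ≤ C := (norm_nonneg _).trans (hx 0)
  have hKC : ∀ m, ∀ c ∈ K m, ‖L c‖ ≤ C := by
    intro m c hc
    have : K m ⊆ L ⁻¹' Metric.closedBall 0 C := by
      apply convexHull_min
      · rintro _ ⟨j, -, rfl⟩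
        simpa [L] using hx j
      · exact (convex_closedBall _ _).linear_preimage L
    simpa using this hc
  set d : ℕ → ℝ := fun m => sInf ((fun c => ‖L c‖ ^ 2) '' K m)
  have hbdd : ∀ m, BddBelow ((fun c => ‖L c‖ ^ 2) '' K m) := fun m =>
    ⟨0, by rintro _ ⟨c, -, rfl⟩; positivity⟩
  have hdle : ∀ m, ∀ c ∈ K m, d m ≤ ‖L c‖ ^ 2 := fun m c hc => csInf_le (hbdd m) ⟨c, hc, rfl⟩
  have hdmono : Monotone d := fun m l h =>
    csInf_le_csInf (hbdd m) ((hKne l).image _) (image_mono (hKanti h))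
  have hdC : ∀ m, d m ≤ C ^ 2 := fun m => by
    obtain ⟨c, hc⟩ := hKne m
    exact (hdle m c hc).trans (by gcongr; exact hKC m c hc)
  have hex : ∀ m : ℕ, ∃ c ∈ K m, ‖L c‖ ^ 2 < d m + 1 / ((m : ℝ) + 1) := fun m => by
    obtain ⟨_, ⟨c, hc, rfl⟩, h⟩ := exists_lt_of_csInf_lt ((hKne m).image _)
      (lt_add_of_pos_right (d m) (show (0:ℝ) < 1 / ((m : ℝ) + 1) by positivity))
    exact ⟨c, hc, h⟩
  choose c hcK hc using hex
  refine ⟨c, hcK, cauchySeq_tendsto_of_complete ?_⟩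
  have hdt : Tendsto d atTop (𝓝 (⨆ m, d m)) :=
    tendsto_atTop_ciSup hdmono ⟨C ^ 2, by rintro _ ⟨m, rfl⟩; exact hdC m⟩
  have hone := tendsto_one_div_add_atTop_nhds_zero_nat (𝕜 := ℝ)
  set D := ⨆ m, d m
  have hdD : ∀ m, d m ≤ D := fun m => hdmono.ge_of_tendsto hdt m
  have key : ∀ N m l, N ≤ m → N ≤ l →
      ‖L (c m) - L (c l)‖ ^ 2 ≤ 4 * (D - d N) + 4 * (1 / ((N : ℝ) + 1)) := by
    intro N m l hm hl
    have hmid : (1 / 2 : ℝ) • c m + (1 / 2 : ℝ) • c l ∈ K N :=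
      (convex_convexHull ℝ _) (hKanti hm (hcK m)) (hKanti hl (hcK l)) (by norm_num) (by norm_num)
        (by norm_num)
    have h1 := hdle N _ hmid
    have h2 : ‖L ((1 / 2 : ℝ) • c m + (1 / 2 : ℝ) • c l)‖ ^ 2
        = ‖L (c m) + L (c l)‖ ^ 2 / 4 := by
      rw [map_add, map_smul, map_smul, ← smul_add, norm_smul, mul_pow]
      norm_num; ring
    have h3 := parallelogram_law_with_norm ℝ (L (c m)) (L (c l))
    have h4 : 1 / ((m : ℝ) + 1) ≤ 1 / ((N : ℝ) + 1) := by gcongr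
    have h5 : 1 / ((l : ℝ) + 1) ≤ 1 / ((N : ℝ) + 1) := by gcongr
    nlinarith [hc m, hc l, hdD m, hdD l]
  rw [Metric.cauchySeq_iff]
  intro ε hε
  have hlim : Tendsto (fun N : ℕ => 4 * (D - d N) + 4 * (1 / ((N : ℝ) + 1))) atTop (𝓝 0) := by
    simpa using ((tendsto_const_nhds (x := D)).sub hdt |>.const_mul 4).add (hone.const_mul 4)
  obtain ⟨N, hN⟩ := (hlim.eventually (gt_mem_nhds (show 0 < ε ^ 2 by positivity))).exists
  refine ⟨N, fun m hm l hl => ?_⟩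
  rw [dist_eq_norm]
  exact lt_of_pow_lt_pow_left₀ 2 hε.le ((key N m l hm hl).trans_lt hN)

theorem exists_weakly_tendsto_subseq {H : Type*} [NormedAddCommGroup H]
    [InnerProductSpace ℝ H] [CompleteSpace H] [SecondCountableTopology H] (x : ℕ → H) (C : ℝ)
    (hx : ∀ j, ‖x j‖ ≤ C) :
    ∃ σ : ℕ → ℕ, StrictMono σ ∧ ∃ y : H, ∀ z : H,
      Tendsto (fun j => inner ℝ (x (σ j)) z) atTop (𝓝 (inner ℝ y z)) := by
  have hs := WeakDual.isSeqCompact_closedBall (𝕜 := ℝ) (E := H) 0 C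
  obtain ⟨a, -, σ, hσ, ha⟩ := @hs (fun j => StrongDual.toWeakDual (InnerProductSpace.toDual ℝ H (x j)))
    (fun j => by simpa using hx j)
  refine ⟨σ, hσ, (InnerProductSpace.toDual ℝ H).symm (WeakDual.toStrongDual a), fun z => ?_⟩
  have := ((WeakDual.eval_continuous z).tendsto a).comp ha
  simp only [InnerProductSpace.toDual_symm_apply]
  exact this

theorem lintegral_enorm_sub_translate_le {E : Type*} [NormedAddCommGroup E] [NormedSpace ℝ E]
    [FiniteDimensional ℝ E] [MeasurableSpace E] [BorelSpace E] (μ : Measure E)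
    [μ.IsAddHaarMeasure] {w : E → ℝ} (hw : ContDiff ℝ 1 w) (y : E) :
    ∫⁻ x, ‖w (x + y) - w x‖ₑ ∂μ ≤ ‖y‖ₑ * ∫⁻ x, ‖fderiv ℝ w x‖ₑ ∂μ := by
  have hcont : Continuous (fderiv ℝ w) := hw.continuous_fderiv one_ne_zero
  have hpt : ∀ x, ‖w (x + y) - w x‖ₑ
      ≤ ∫⁻ t in Ioc (0 : ℝ) 1, ‖fderiv ℝ w (x + t • y)‖ₑ * ‖y‖ₑ := by
    intro x
    have hd : ∀ t ∈ uIcc (0 : ℝ) 1,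
        HasDerivAt (fun t : ℝ => w (x + t • y)) (fderiv ℝ w (x + t • y) y) t := by
      intro t _
      have h1 : HasDerivAt (fun t : ℝ => x + t • y) y t := by
        simpa using ((hasDerivAt_id t).smul_const y).const_add x
      exact ((hw.differentiable one_ne_zero _).hasFDerivAt).comp_hasDerivAt t h1
    have hc : Continuous (fun t : ℝ => fderiv ℝ w (x + t • y) y) := by fun_prop
    have := intervalIntegral.integral_eq_sub_of_hasDerivAt hd (hc.intervalIntegrable _ _)
    simp only [one_smul, zero_smul, add_zero] at this
    rw [← this, intervalIntegral.integral_of_le zero_le_one]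
    refine (enorm_integral_le_lintegral_enorm _).trans (lintegral_mono fun t => ?_)
    exact ContinuousLinearMap.le_opENorm _ _
  calc ∫⁻ x, ‖w (x + y) - w x‖ₑ ∂μ
      ≤ ∫⁻ x, (∫⁻ t : ℝ in Ioc 0 1, ‖fderiv ℝ w (x + t • y)‖ₑ * ‖y‖ₑ) ∂μ := lintegral_mono hpt
    _ = ∫⁻ t : ℝ in Ioc 0 1, ∫⁻ x, ‖fderiv ℝ w (x + t • y)‖ₑ * ‖y‖ₑ ∂μ ∂volume := by
        refine lintegral_lintegral_swap ?_
        refine Measurable.aemeasurable (Continuous.measurable ?_)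
        simp only [Function.uncurry_def]
        refine ENNReal.continuous_mul_const (by simp) |>.comp ?_
        fun_prop
    _ = ∫⁻ _t : ℝ in Ioc 0 1, (‖y‖ₑ * ∫⁻ x, ‖fderiv ℝ w x‖ₑ ∂μ) := by
        refine lintegral_congr fun t => ?_
        rw [lintegral_mul_const' _ _ (by simp),
          lintegral_add_right_eq_self (fun x => ‖fderiv ℝ w x‖ₑ), mul_comm]
    _ = _ := by simp

theorem lintegral_enorm_sub_average_le {E : Type*} [NormedAddCommGroup E] [NormedSpace ℝ E]
    [FiniteDimensional ℝ E] [MeasurableSpace E] [BorelSpace E] (μ : Measure E)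
    [μ.IsAddHaarMeasure] {w : E → ℝ} (hw : ContDiff ℝ 1 w) {ε : ℝ} (hε : 0 < ε) :
    ∫⁻ x, ‖(⨍ y in Metric.ball 0 ε, w (x + y) ∂μ) - w x‖ₑ ∂μ
      ≤ ENNReal.ofReal ε * ∫⁻ x, ‖fderiv ℝ w x‖ₑ ∂μ := by
  set B := Metric.ball (0 : E) ε
  have hB0 : μ B ≠ 0 := (Metric.measure_ball_pos μ 0 hε).ne'
  have hBt : μ B ≠ ⊤ := measure_ball_lt_top.ne
  have hint : ∀ x, IntegrableOn (fun y => w (x + y)) B μ := fun x =>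
    ((hw.continuous.comp (by fun_prop : Continuous fun y => x + y)).continuousOn.integrableOn_compact
      (isCompact_closedBall (0 : E) ε)).mono_set Metric.ball_subset_closedBall
  have : IsFiniteMeasure (μ.restrict B) := ⟨by simpa using hBt.lt_top⟩
  have hpt : ∀ x, ‖(⨍ y in B, w (x + y) ∂μ) - w x‖ₑ
      ≤ (μ B)⁻¹ * ∫⁻ y in B, ‖w (x + y) - w x‖ₑ ∂μ := by
    intro x
    have h1 : (⨍ y in B, w (x + y) ∂μ) - w x = ⨍ y in B, (w (x + y) - w x) ∂μ := by
      rw [setAverage_eq, setAverage_eq, integral_sub (hint x) (integrable_const _), smul_sub]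
      congr 1
      rw [integral_const, smul_smul]
      simp only [Measure.real, Measure.restrict_apply_univ]
      rw [inv_mul_cancel₀ (ENNReal.toReal_ne_zero.2 ⟨hB0, hBt⟩), one_smul]
    rw [h1, setAverage_eq, enorm_smul]
    gcongr
    · rw [Real.enorm_eq_ofReal (by positivity), measureReal_def, ENNReal.ofReal_inv_of_pos
        (ENNReal.toReal_pos hB0 hBt), ENNReal.ofReal_toReal hBt]
    · exact enorm_integral_le_lintegral_enorm _
  have hmeas : Measurable (Function.uncurry fun x y : E => ‖w (x + y) - w x‖ₑ) := by
    refine Continuous.measurable ?_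
    have := hw.continuous
    simp only [Function.uncurry_def]
    fun_prop
  calc ∫⁻ x, ‖(⨍ y in B, w (x + y) ∂μ) - w x‖ₑ ∂μ
      ≤ ∫⁻ x, (μ B)⁻¹ * ∫⁻ y in B, ‖w (x + y) - w x‖ₑ ∂μ ∂μ := lintegral_mono hpt
    _ = (μ B)⁻¹ * ∫⁻ y in B, ∫⁻ x, ‖w (x + y) - w x‖ₑ ∂μ ∂μ := by
        rw [lintegral_const_mul' _ _ (ENNReal.inv_ne_top.2 hB0),
          lintegral_lintegral_swap hmeas.aemeasurable]
    _ ≤ (μ B)⁻¹ * ∫⁻ y in B, ENNReal.ofReal ε * ∫⁻ x, ‖fderiv ℝ w x‖ₑ ∂μ ∂μ := by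
        gcongr 1
        refine setLIntegral_mono' measurableSet_ball fun y hy => ?_
        refine (lintegral_enorm_sub_translate_le μ hw y).trans ?_
        gcongr
        rw [← ofReal_norm]
        exact ENNReal.ofReal_le_ofReal (by simpa [B] using (mem_ball_zero_iff.1 hy).le)
    _ = _ := by
        rw [lintegral_const, Measure.restrict_apply_univ, mul_comm, mul_assoc,
          ENNReal.mul_inv_cancel hB0 hBt, mul_one]

/-- A Rellich-Kondrachov type statement: a sequence of compactly supported functions in a bounded
open set that is bounded in `L²` and has gradients bounded in `L¹` has an `L¹`-Cauchy
subsequence. -/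
theorem exists_subseq_cauchy_of_gradient_bounded {E : Type*} [NormedAddCommGroup E]
    [NormedSpace ℝ E] [FiniteDimensional ℝ E] [MeasurableSpace E] [BorelSpace E] (μ : Measure E)
    [μ.IsAddHaarMeasure] {Ω : Set E} (hΩb : Bornology.IsBounded Ω)
    {w : ℕ → E → ℝ} (hw : ∀ j, ContDiff ℝ 1 (w j)) (hwc : ∀ j, HasCompactSupport (w j))
    (hwΩ : ∀ j, tsupport (w j) ⊆ Ω) {A B : NNReal} (hA : ∀ j, eLpNorm (w j) 2 μ ≤ A)
    (hB : ∀ j, ∫⁻ x, ‖fderiv ℝ (w j) x‖ₑ ∂μ ≤ B) :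
    ∃ σ : ℕ → ℕ, StrictMono σ ∧ ∀ ε : ENNReal, 0 < ε → ∃ N, ∀ j ≥ N, ∀ l ≥ N,
      eLpNorm (w (σ j) - w (σ l)) 1 μ ≤ ε := by
  have hmem : ∀ j, MemLp (w j) 2 μ := fun j => (hw j).continuous.memLp_of_hasCompactSupport (hwc j)
  have : Fact ((2 : ENNReal) ≠ ⊤) := ⟨ENNReal.ofNat_ne_top⟩
  obtain ⟨σ, hσ, y, hy⟩ := exists_weakly_tendsto_subseq (fun j => (hmem j).toLp (w j)) A (fun j => by
    rw [Lp.norm_toLp]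
    exact ENNReal.toReal_le_of_le_ofReal A.2 (by simpa using hA j))
  refine ⟨σ, hσ, fun ε hε => ?_⟩
  obtain ⟨δ, hδ, hδε⟩ : ∃ δ : ℝ, 0 < δ ∧ ENNReal.ofReal δ * B ≤ ε / 4 := by
    obtain ⟨η, hη, h⟩ := ENNReal.lt_iff_exists_nnreal_btwn.1
      (ENNReal.div_pos hε.ne' (show (4 : ENNReal) ≠ ⊤ by simp))
    have hη' : 0 < η := by simpa using hη
    refine ⟨η / (B + 1), by positivity, ?_⟩
    refine le_trans ?_ h.le
    rw [← ENNReal.ofReal_coe_nnreal, ← ENNReal.ofReal_mul (by positivity),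
      ← ENNReal.ofReal_coe_nnreal]
    apply ENNReal.ofReal_le_ofReal
    rw [div_mul_eq_mul_div, div_le_iff₀ (by positivity)]
    have := η.2
    have := B.2
    gcongr
    simp
  set a : ℕ → E → ℝ := fun j x => ⨍ z in Metric.ball 0 δ, w (σ j) (x + z) ∂μ
  have hball : ∀ x, μ (Metric.ball x δ) ≠ ⊤ := fun x => measure_ball_lt_top.ne
  have haeq : ∀ j x, a j x = (μ.real (Metric.ball 0 δ))⁻¹ *
      inner ℝ (indicatorConstLp 2 measurableSet_ball (hball x) (1 : ℝ))
        ((hmem (σ j)).toLp (w (σ j))) := by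
    intro j x
    rw [L2.inner_indicatorConstLp_one measurableSet_ball (hball x)]
    simp only [a, setAverage_eq, smul_eq_mul]
    congr 1
    rw [setIntegral_congr_ae (g := w (σ j)) measurableSet_ball
      ((hmem (σ j)).coeFn_toLp.mono fun _ h _ => h)]
    rw [← integral_indicator measurableSet_ball, ← integral_indicator measurableSet_ball,
      ← integral_add_left_eq_self ((Metric.ball x δ).indicator (w (σ j))) x]
    congr 1 with z
    simp [indicator, dist_eq_norm]
  have hameas : ∀ j, StronglyMeasurable (a j) := by
    intro j
    simp only [a, setAverage_eq]
    have hcont := (hw (σ j)).continuous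
    have hm : StronglyMeasurable fun x => ∫ z in Metric.ball 0 δ, w (σ j) (x + z) ∂μ :=
      StronglyMeasurable.integral_prod_right (f := fun x z => w (σ j) (x + z))
        (Continuous.stronglyMeasurable (by simp only [Function.uncurry_def]; fun_prop))
    exact hm.const_smul (μ.real (Metric.ball 0 δ))⁻¹
  have habd : ∀ j x, ‖a j x‖ ≤ (μ.real (Metric.ball 0 δ))⁻¹ *
      (μ.real (Metric.ball 0 δ) ^ (1 / (2 : ENNReal).toReal) * A) := by
    intro j x
    rw [haeq, norm_mul, Real.norm_of_nonneg (by positivity)]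
    gcongr
    refine (norm_inner_le_norm _ _).trans ?_
    gcongr
    · refine norm_indicatorConstLp_le.trans ?_
      rw [norm_one, one_mul, measureReal_def, measureReal_def, Measure.addHaar_ball_center μ x]
    · rw [Lp.norm_toLp]
      exact ENNReal.toReal_le_of_le_ofReal A.2 (by simpa using hA (σ j))
  have : IsFiniteMeasure (μ.restrict Ω) := ⟨by simpa using hΩb.measure_lt_top⟩
  have hlim := tendsto_lintegral_norm_of_dominated_convergence (μ := μ.restrict Ω) (F := a)
    (f := fun x => (μ.real (Metric.ball 0 δ))⁻¹ *
      inner ℝ y (indicatorConstLp 2 measurableSet_ball (hball x) (1 : ℝ)))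
    (fun j => (hameas j).aestronglyMeasurable) (hasFiniteIntegral_const _)
    (fun j => Eventually.of_forall (habd j))
    (Eventually.of_forall fun x => by
      simp only [haeq]
      refine Tendsto.const_mul _ ?_
      simp_rw [real_inner_comm _ (indicatorConstLp 2 measurableSet_ball (hball x) (1 : ℝ))]
      exact hy _)
  set h : E → ℝ := fun x => (μ.real (Metric.ball 0 δ))⁻¹ *
      inner ℝ y (indicatorConstLp 2 measurableSet_ball (hball x) (1 : ℝ))
  have hε4 : 0 < ε / 4 := ENNReal.div_pos hε.ne' (by simp)
  obtain ⟨N, hN⟩ := eventually_atTop.1 (hlim.eventually (ge_mem_nhds hε4))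
  refine ⟨N, fun j hj l hl => ?_⟩
  have hsupp : Function.support (w (σ j) - w (σ l)) ⊆ Ω := by
    refine (Function.support_sub _ _).trans (union_subset ?_ ?_)
    · exact (subset_tsupport _).trans (hwΩ _)
    · exact (subset_tsupport _).trans (hwΩ _)
  rw [← eLpNorm_restrict_eq_of_support_subset hsupp, eLpNorm_one_eq_lintegral_enorm]
  have hpt : ∀ x, ‖(w (σ j) - w (σ l)) x‖ₑ ≤ ‖a j x - w (σ j) x‖ₑ + ‖a l x - w (σ l) x‖ₑ +
      ENNReal.ofReal ‖a j x - h x‖ + ENNReal.ofReal ‖a l x - h x‖ := by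
    intro x
    simp only [← ofReal_norm]
    rw [← ENNReal.ofReal_add (by positivity) (by positivity),
      ← ENNReal.ofReal_add (by positivity) (by positivity),
      ← ENNReal.ofReal_add (by positivity) (by positivity)]
    refine ENNReal.ofReal_le_ofReal ?_
    have : (w (σ j) - w (σ l)) x = -(a j x - w (σ j) x) + (a l x - w (σ l) x) + (a j x - h x)
      - (a l x - h x) := by simp only [Pi.sub_apply]; ring
    rw [this]
    refine (norm_sub_le _ _).trans ?_
    gcongr
    refine norm_add₃_le.trans ?_
    rw [norm_neg]
  have hm1 : ∀ j, Measurable fun x => ‖a j x - w (σ j) x‖ₑ := fun j =>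
    ((hameas j).measurable.sub (hw (σ j)).continuous.measurable).enorm
  have hA1 : ∀ j, ∫⁻ x in Ω, ‖a j x - w (σ j) x‖ₑ ∂μ ≤ ε / 4 := fun j =>
    (setLIntegral_le_lintegral _ _).trans <|
      (lintegral_enorm_sub_average_le μ (hw (σ j)) hδ).trans ((mul_le_mul_right (hB _) _).trans hδε)
  have hhm : AEMeasurable h (μ.restrict Ω) := by
    refine aemeasurable_of_tendsto_metrizable_ae atTop (f := a)
      (fun j => (hameas j).measurable.aemeasurable) (Eventually.of_forall fun x => ?_)
    simp only [haeq, h]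
    refine Tendsto.const_mul _ ?_
    simp_rw [real_inner_comm _ (indicatorConstLp 2 measurableSet_ball (hball x) (1 : ℝ))]
    exact hy _
  have hm2 : AEMeasurable (fun x => ENNReal.ofReal ‖a j x - h x‖) (μ.restrict Ω) :=
    ((hameas j).measurable.aemeasurable.sub hhm).norm.ennreal_ofReal
  have hm3 : AEMeasurable (fun x => ENNReal.ofReal ‖a l x - h x‖) (μ.restrict Ω) :=
    ((hameas l).measurable.aemeasurable.sub hhm).norm.ennreal_ofReal
  refine (lintegral_mono hpt).trans ?_
  rw [lintegral_add_right' _ hm3, lintegral_add_right' _ hm2, lintegral_add_right _ (hm1 l)]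
  calc _ ≤ ε / 4 + ε / 4 + ε / 4 + ε / 4 :=
        add_le_add (add_le_add (add_le_add (hA1 j) (hA1 l)) (hN j hj)) (hN l hl)
    _ = ε := by
        have : ε / 4 + ε / 4 + ε / 4 + ε / 4 = 4 * (ε / 4) := by ring
        rw [this, ENNReal.mul_div_cancel (by simp) (by simp)]

theorem memLp_norm_rpow_neg_ball {E : Type*} [NormedAddCommGroup E] [NormedSpace ℝ E]
    [FiniteDimensional ℝ E] [Nontrivial E] [MeasurableSpace E] [BorelSpace E] (μ : Measure E)
    [μ.IsAddHaarMeasure] {a t R : ℝ} (ht : 0 < t) (hR : 0 < R)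
    (hat : a * t < Module.finrank ℝ E) :
    MemLp (fun x : E => ‖x‖ ^ (-a)) (ENNReal.ofReal t) (μ.restrict (Metric.ball 0 R)) := by
  have hm : AEStronglyMeasurable (fun x : E => ‖x‖ ^ (-a)) (μ.restrict (Metric.ball 0 R)) :=
    (measurable_norm.pow_const _).aestronglyMeasurable
  rw [← integrable_norm_rpow_iff hm (by simpa using ht) (by simp), ENNReal.toReal_ofReal ht.le]
  have hd : 0 < Module.finrank ℝ E := Module.finrank_pos
  have h := (integrableOn_fun_norm_addHaar μ (r := R) (f := fun y : ℝ => (y ^ (-a)) ^ t)).2 (by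
    have h0 : -1 < ((Module.finrank ℝ E : ℝ) - 1) - a * t := by linarith
    refine ((intervalIntegral.integrableOn_Ioo_rpow_iff hR).2 h0).congr_fun (fun y hy => ?_)
      measurableSet_Ioo
    have hy : 0 < y := hy.1
    simp only [smul_eq_mul]
    rw [← Real.rpow_mul hy.le, ← Real.rpow_natCast, ← Real.rpow_add hy, Nat.cast_sub hd]
    congr 1
    push_cast
    ring)
  refine h.congr (Eventually.of_forall fun x => ?_)
  simp only [Real.norm_of_nonneg (Real.rpow_nonneg (norm_nonneg x) (-a))]

theorem norm_fderiv_norm_rpow_le_weight {E : Type*} [NormedAddCommGroup E] [NormedSpace ℝ E]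
    {w : E → ℝ} (hw : Differentiable ℝ w) {β k : ℝ} (hk : 0 < k) {x : E} (hx : x ≠ 0) :
    ‖fderiv ℝ (fun x => ‖w x‖ ^ (1 + k / 2)) x‖ ≤ (1 + k / 2) *
      (‖x‖ ^ (-(β / 2)) * (‖x‖ ^ (β / 2) * |w x| ^ (k / 2) * ‖fderiv ℝ w x‖)) := by
  refine (norm_fderiv_norm_rpow_le hw (by linarith : 1 < 1 + k / 2)).trans (le_of_eq ?_)
  have : ‖x‖ ^ (-(β / 2)) * ‖x‖ ^ (β / 2) = 1 := by
    rw [← Real.rpow_add (norm_pos_iff.2 hx)]; simp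
  rw [Real.norm_eq_abs, add_sub_cancel_left]
  linear_combination (-(1 + k / 2) * |w x| ^ (k / 2) * ‖fderiv ℝ w x‖) * this

theorem exists_eLpNorm_rpow_le_weighted {E : Type*} [NormedAddCommGroup E] [InnerProductSpace ℝ E]
    [FiniteDimensional ℝ E] [MeasurableSpace E] [BorelSpace E] (μ : Measure E)
    [μ.IsAddHaarMeasure] {n : ℕ} (hdim : Module.finrank ℝ E = n) (hn : 3 ≤ n) {q : ℝ}
    (hq : q = 2 * n / (n - 2)) {Ω : Set E} (hΩb : Bornology.IsBounded Ω) {β k : ℝ} (hk0 : 0 < k)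
    (hkq : k ≤ q) (hβ0 : 0 ≤ β) (hβ : β < k * n / q) :
    ∃ s : ℝ, q < s ∧ ∃ C : NNReal, ∀ w : E → ℝ, ContDiff ℝ 1 w → HasCompactSupport w →
      tsupport w ⊆ Ω → eLpNorm w (ENNReal.ofReal s) μ ^ (1 + k / 2) ≤
        C * eLpNorm (fun x => ‖x‖ ^ (β / 2) * |w x| ^ (k / 2) * ‖fderiv ℝ w x‖) 2 μ := by
  have hn' : (3 : ℝ) ≤ n := by exact_mod_cast hn
  have : Nontrivial E := Module.nontrivial_of_finrank_pos (R := ℝ) (by omega)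
  have hq0 : 0 < q := by rw [hq]; apply div_pos <;> linarith
  have hqinv : q⁻¹ = 1 / 2 - 1 / n := by
    rw [hq]; field_simp
  set p : ℝ := 1 + k / 2
  have hp1 : 1 < p := by simp only [p]; linarith
  obtain ⟨τ, hτ1, hτ2⟩ : ∃ τ : ℝ, β / (2 * n) < τ ∧ τ < k / 2 * q⁻¹ := by
    apply exists_between
    rw [lt_div_iff₀ hq0] at hβ
    rw [← div_eq_mul_inv, div_lt_div_iff₀ (by linarith) hq0]
    nlinarith
  have hτ0 : 0 < τ := lt_of_le_of_lt (by positivity) hτ1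
  have hτh : τ < 1 / 2 := by
    refine hτ2.trans_le ?_
    rw [← div_eq_mul_inv, div_le_iff₀ hq0]
    linarith
  have hqinv0 : 0 < q⁻¹ := inv_pos.2 hq0
  obtain ⟨r, hr⟩ : ∃ r : NNReal, (r : ℝ) = (1 / 2 + τ)⁻¹ := ⟨⟨_, by positivity⟩, rfl⟩
  obtain ⟨r', hr'⟩ : ∃ r : NNReal, (r : ℝ) = (q⁻¹ + τ)⁻¹ := ⟨⟨_, by positivity⟩, rfl⟩
  have hr1 : 1 ≤ r := by
    rw [← NNReal.coe_le_coe, hr]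
    exact (one_le_inv₀ (by positivity)).2 (by linarith)
  have hrr' : (r' : ℝ)⁻¹ = (r : ℝ)⁻¹ - (Module.finrank ℝ E : ℝ)⁻¹ := by
    rw [hr, hr', inv_inv, inv_inv, hdim, hqinv]
    ring
  refine ⟨r' * p, ?_, ?_⟩
  · rw [hr', inv_mul_eq_div, lt_div_iff₀ (by positivity), mul_add, mul_inv_cancel₀ hq0.ne']
    simp only [p]
    rw [← div_eq_mul_inv, lt_div_iff₀ hq0] at hτ2
    linarith
  obtain ⟨R, hR⟩ := hΩb.subset_ball (0 : E)
  obtain ⟨R, hR0, hR⟩ : ∃ R : ℝ, 0 < R ∧ Ω ⊆ Metric.ball 0 R :=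
    ⟨max R 1, by positivity, hR.trans (Metric.ball_subset_ball (le_max_left _ _))⟩
  have hW := memLp_norm_rpow_neg_ball μ (a := β / 2) (inv_pos.2 hτ0) hR0 (by
    rw [hdim, ← div_eq_mul_inv, div_lt_iff₀ hτ0]
    rw [div_lt_iff₀ (by positivity)] at hτ1
    linarith)
  have hH : ENNReal.HolderTriple (ENNReal.ofReal τ⁻¹) 2 (r : ENNReal) := ⟨by
    have h2 : (2 : ENNReal)⁻¹ = ENNReal.ofReal (1 / 2) := by
      rw [one_div, ENNReal.ofReal_inv_of_pos two_pos]; simp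
    have h3 : (r : ENNReal) = ENNReal.ofReal (1 / 2 + τ)⁻¹ := by
      rw [← ENNReal.ofReal_coe_nnreal, hr]
    rw [h3, ENNReal.ofReal_inv_of_pos hτ0, ENNReal.ofReal_inv_of_pos (by positivity), inv_inv,
      inv_inv, h2, ← ENNReal.ofReal_add hτ0.le (by norm_num), add_comm]⟩
  set W := eLpNorm (fun x : E => ‖x‖ ^ (-(β / 2))) (ENNReal.ofReal τ⁻¹)
    (μ.restrict (Metric.ball 0 R))
  refine ⟨SNormLESNormFDerivOfEqConst ℝ μ r * (Real.toNNReal p * W.toNNReal), ?_⟩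
  intro w hw hwc hwΩ
  have hv1 : ContDiff ℝ 1 (fun x => ‖w x‖ ^ p) := hw.norm_rpow hp1
  have hvc : HasCompactSupport (fun x => ‖w x‖ ^ p) :=
    hwc.comp_left (g := fun t : ℝ => ‖t‖ ^ p) (by simp [(by linarith : p ≠ 0)])
  have hGNS := eLpNorm_le_eLpNorm_fderiv_of_eq (μ := μ) hv1 hvc hr1 (by omega) hrr'
  rw [eLpNorm_norm_rpow _ (by linarith)] at hGNS
  have hs : (r' : ENNReal) * ENNReal.ofReal p = ENNReal.ofReal (r' * p) := by
    rw [ENNReal.ofReal_mul r'.coe_nonneg]; simp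
  rw [hs] at hGNS
  refine hGNS.trans ?_
  push_cast
  rw [mul_assoc]
  gcongr
  set F : E → ℝ := fun x => ‖x‖ ^ (β / 2) * |w x| ^ (k / 2) * ‖fderiv ℝ w x‖
  have hcd : Continuous (fderiv ℝ w) := hw.continuous_fderiv one_ne_zero
  have hFm : AEStronglyMeasurable F (μ.restrict (Metric.ball 0 R)) :=
    (((measurable_norm.pow_const _).mul (hw.continuous.measurable.abs.pow_const _)).mul
      hcd.norm.measurable).aestronglyMeasurable
  have hsup : Function.support (fderiv ℝ fun x => ‖w x‖ ^ p) ⊆ Metric.ball 0 R := by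
    refine (support_fderiv_subset ℝ).trans (Subset.trans ?_ (hwΩ.trans hR))
    exact closure_mono fun x hx => by
      simp only [Function.mem_support] at hx ⊢
      rintro h
      exact hx (by simp [h, (by linarith : p ≠ 0)])
  have hsup' : Function.support (fun x => ‖fderiv ℝ (fun x => ‖w x‖ ^ p) x‖) ⊆ Metric.ball 0 R :=
    fun x hx => hsup (by simpa using hx)
  rw [← eLpNorm_norm, ← eLpNorm_restrict_eq_of_support_subset hsup']
  calc eLpNorm (fun x => ‖fderiv ℝ (fun x => ‖w x‖ ^ p) x‖) r (μ.restrict (Metric.ball 0 R))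
      ≤ ENNReal.ofReal p * eLpNorm ((fun x : E => ‖x‖ ^ (-(β / 2))) • F) r
          (μ.restrict (Metric.ball 0 R)) := by
        refine eLpNorm_le_mul_eLpNorm_of_ae_le_mul ?_ _
        have h0 : ∀ᵐ x ∂(μ.restrict (Metric.ball 0 R)), x ≠ 0 :=
          ae_restrict_of_ae (Measure.ae_ne μ 0)
        filter_upwards [h0] with x hx
        rw [norm_norm]
        refine (norm_fderiv_norm_rpow_le_weight (hw.differentiable one_ne_zero) hk0 hx
          (β := β)).trans (le_of_eq ?_)
        simp only [Pi.smul_apply', smul_eq_mul, F]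
        rw [Real.norm_of_nonneg (by positivity)]
    _ ≤ ENNReal.ofReal p * (W * eLpNorm F 2 (μ.restrict (Metric.ball 0 R))) := by
        gcongr
        exact eLpNorm_smul_le_mul_eLpNorm hFm hW.1
    _ ≤ p.toNNReal * W.toNNReal * eLpNorm F 2 μ := by
        rw [ENNReal.coe_toNNReal hW.2.ne, mul_assoc]
        gcongr
        · rfl
        · exact Measure.restrict_le_self

theorem lintegral_rpow_le_interpolate {α : Type*} [MeasurableSpace α] {μ : Measure α}
    {f : α → ENNReal} (hf : AEMeasurable f μ) {q s : ℝ} (hq : 1 < q) (hs : q < s) :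
    ∫⁻ x, f x ^ q ∂μ ≤
      (∫⁻ x, f x ∂μ) ^ ((s - q) / (s - 1)) * (∫⁻ x, f x ^ s ∂μ) ^ ((q - 1) / (s - 1)) := by
  have h1 : 0 < s - 1 := by linarith
  have h2 : 0 ≤ (s - q) / (s - 1) := div_nonneg (by linarith) h1.le
  have h3 : 0 ≤ (q - 1) / (s - 1) := div_nonneg (by linarith) h1.le
  refine le_trans (le_of_eq (lintegral_congr fun x => ?_))
    (ENNReal.lintegral_mul_norm_pow_le hf (hf.pow_const s) h2 h3 (by field_simp; ring))
  rw [← ENNReal.rpow_mul, ← ENNReal.rpow_add_of_nonneg _ _ h2 (mul_nonneg (by linarith) h3)]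
  congr 1
  field_simp
  ring

theorem eLpNorm_ofReal_rpow_eq_lintegral {α F : Type*} [MeasurableSpace α] {μ : Measure α}
    [NormedAddCommGroup F] (f : α → F) {q : ℝ} (hq : 0 < q) :
    eLpNorm f (ENNReal.ofReal q) μ ^ q = ∫⁻ x, ‖f x‖ₑ ^ q ∂μ := by
  rw [eLpNorm_eq_lintegral_rpow_enorm_toReal (by simpa using hq) (by simp),
    ENNReal.toReal_ofReal hq.le, ← ENNReal.rpow_mul, one_div, inv_mul_cancel₀ hq.ne',
    ENNReal.rpow_one]

theorem exists_tendsto_eLpNorm_of_cauchy_one {α : Type*} [MeasurableSpace α] {μ : Measure α}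
    {f : ℕ → α → ℝ} {q s : ℝ} (hq : 1 < q) (hs : q < s)
    (hf : ∀ j, MemLp (f j) (ENNReal.ofReal q) μ) {C : NNReal}
    (hC : ∀ j, eLpNorm (f j) (ENNReal.ofReal s) μ ≤ C)
    (hcau : ∀ ε : ENNReal, 0 < ε → ∃ N, ∀ j ≥ N, ∀ l ≥ N, eLpNorm (f j - f l) 1 μ ≤ ε) :
    ∃ u : α → ℝ, MemLp u (ENNReal.ofReal q) μ ∧
      Tendsto (fun j => eLpNorm (f j - u) (ENNReal.ofReal q) μ) atTop (𝓝 0) := by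
  have hq0 : 0 < q := by linarith
  have hs0 : 0 < s := by linarith
  have : Fact (1 ≤ ENNReal.ofReal q) := ⟨by simpa using hq.le⟩
  set K : ENNReal := ((C + C : ENNReal) ^ s) ^ ((q - 1) / (s - 1))
  have hK : K ≠ ⊤ := by
    have h3 : 0 ≤ (q - 1) / (s - 1) := div_nonneg (by linarith) (by linarith)
    exact ENNReal.rpow_ne_top_of_nonneg h3 (ENNReal.rpow_ne_top_of_nonneg hs0.le (by simp))
  have hθ : 0 < (s - q) / (s - 1) := div_pos (by linarith) (by linarith)
  have hest : ∀ j l, eLpNorm (f j - f l) (ENNReal.ofReal q) μ ^ q ≤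
      eLpNorm (f j - f l) 1 μ ^ ((s - q) / (s - 1)) * K := by
    intro j l
    rw [eLpNorm_ofReal_rpow_eq_lintegral _ hq0, eLpNorm_one_eq_lintegral_enorm]
    refine (lintegral_rpow_le_interpolate ((hf j).1.sub (hf l).1).enorm hq hs).trans ?_
    rw [← eLpNorm_ofReal_rpow_eq_lintegral _ hs0]
    have h3 : 0 ≤ (q - 1) / (s - 1) := div_nonneg (by linarith) (by linarith)
    simp only [K]
    gcongr
    exact (eLpNorm_sub_le (hf j).1 (hf l).1 (by simpa using (hq.trans hs).le)).trans
      (add_le_add (hC j) (hC l))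
  have hlim : Tendsto (fun η : ENNReal => η ^ ((s - q) / (s - 1)) * K) (𝓝 0) (𝓝 0) := by
    have h1 : Tendsto (fun η : ENNReal => η ^ ((s - q) / (s - 1))) (𝓝 0) (𝓝 0) := by
      have := (ENNReal.continuous_rpow_const (y := (s - q) / (s - 1))).tendsto 0
      rwa [ENNReal.zero_rpow_of_pos hθ] at this
    simpa using ENNReal.Tendsto.mul_const h1 (Or.inr hK)
  have hcs : CauchySeq fun j => (hf j).toLp (f j) := by
    rw [EMetric.cauchySeq_iff]
    intro ε hε
    have hεq : 0 < ε ^ q := ENNReal.rpow_pos_of_nonneg hε hq0.le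
    have hev := hlim.eventually (gt_mem_nhds hεq)
    obtain ⟨η, hη0, hη⟩ := ENNReal.nhds_zero_basis_Iic.eventually_iff.1 hev
    obtain ⟨N, hN⟩ := hcau η hη0
    refine ⟨N, fun j hj l hl => ?_⟩
    rw [Lp.edist_toLp_toLp]
    exact lt_of_not_ge fun hge =>
      (((ENNReal.rpow_le_rpow hge hq0.le).trans (hest j l)).trans_lt (hη (hN j hj l hl))).false
  obtain ⟨U, hU⟩ := cauchySeq_tendsto_of_complete hcs
  refine ⟨U, Lp.memLp U, ?_⟩
  have := (Lp.tendsto_Lp_iff_tendsto_eLpNorm'' f hf U (Lp.memLp U)).1 (by simpa using hU)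
  exact this

theorem convex_setOf_eLpNorm_sub_le {α F M : Type*} [MeasurableSpace α] [NormedAddCommGroup F]
    [NormedSpace ℝ F] [AddCommGroup M] [Module ℝ M] {ν : Measure α} {p : ENNReal} (hp : 1 ≤ p)
    (T : M →ₗ[ℝ] α → F) (hT : ∀ c, AEStronglyMeasurable (T c) ν) {v : α → F}
    (hv : AEStronglyMeasurable v ν) (K : ENNReal) :
    Convex ℝ {c | eLpNorm (T c - v) p ν ≤ K} := by
  intro c hc d hd a b ha hb hab
  simp only [mem_ofPred_eq] at hc hd ⊢
  have h1 : T (a • c + b • d) - v = a • (T c - v) + b • (T d - v) := by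
    have : v = a • v + b • v := by rw [← add_smul, hab, one_smul]
    rw [map_add, map_smul, map_smul]
    nth_rewrite 1 [this]
    module
  rw [h1]
  refine (eLpNorm_add_le (((hT c).sub hv).const_smul a) (((hT d).sub hv).const_smul b) hp).trans ?_
  rw [eLpNorm_const_smul, eLpNorm_const_smul, Real.enorm_of_nonneg ha, Real.enorm_of_nonneg hb]
  calc _ ≤ ENNReal.ofReal a * K + ENNReal.ofReal b * K := by gcongr
    _ = K := by rw [← add_mul, ← ENNReal.ofReal_add ha hb, hab]; simp

theorem eLpNorm_two_withDensity_sq {α F : Type*} [MeasurableSpace α] [NormedAddCommGroup F]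
    {μ : Measure α} {W : α → ENNReal} (hW : Measurable W) {f : α → F}
    (hf : AEStronglyMeasurable f μ) :
    eLpNorm f 2 (μ.withDensity W) ^ 2 = ∫⁻ x, W x * ‖f x‖ₑ ^ 2 ∂μ := by
  have h := eLpNorm_ofReal_rpow_eq_lintegral (μ := μ.withDensity W) f (q := 2) two_pos
  simp only [ENNReal.ofReal_ofNat, ENNReal.rpow_ofNat] at h
  rw [h, lintegral_withDensity_eq_lintegral_mul₀ hW.aemeasurable (hf.enorm.pow_const 2)]
  rfl

theorem lintegral_mul_enorm_sq_le_of_tendsto_convexHull {α F : Type*} [MeasurableSpace α]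
    [NormedAddCommGroup F] [NormedSpace ℝ F] {μ : Measure α}
    (T : (ℕ →₀ ℝ) →ₗ[ℝ] α → F) (hT : ∀ c, AEStronglyMeasurable (T c) μ)
    {W : ℕ → α → ENNReal} (hW : ∀ j, Measurable (W j)) {K : ℕ → ENNReal} (hK : Antitone K)
    {S : ENNReal} (hKS : Tendsto K atTop (𝓝 S))
    (hWK : ∀ j, ∫⁻ x, W j x * ‖T (Finsupp.single j 1) x‖ₑ ^ 2 ∂μ ≤ K j)
    {c : ℕ → (ℕ →₀ ℝ)}
    (hc : ∀ m, c m ∈ convexHull ℝ ((fun j => Finsupp.single j (1:ℝ)) '' Ici m))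
    {g : α → F} (hg : ∀ᵐ x ∂μ, Tendsto (fun m => T (c m) x) atTop (𝓝 (g x)))
    {Wlim : α → ENNReal} (hWlim : ∀ᵐ x ∂μ, Tendsto (fun j => W j x) atTop (𝓝 (Wlim x)))
    (hWtop : ∀ x, Wlim x ≠ ⊤) :
    ∫⁻ x, Wlim x * ‖g x‖ₑ ^ 2 ∂μ ≤ S := by
  set A : ℕ → α → ENNReal := fun m x => ⨅ i, W (i + m) x
  have hA : ∀ m, Measurable (A m) := fun m => Measurable.iInf fun i => hW _
  have hAK : ∀ m, ∫⁻ x, A m x * ‖T (c m) x‖ₑ ^ 2 ∂μ ≤ K m := by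
    intro m
    have hac : μ.withDensity (A m) ≪ μ := withDensity_absolutelyContinuous _ _
    have hconv := convex_setOf_eLpNorm_sub_le (ν := μ.withDensity (A m)) (p := 2)
      (by norm_num) T (fun c => (hT c).mono_ac hac) (v := 0) aestronglyMeasurable_const
      (K m ^ (1 / 2 : ℝ))
    have hsub := convexHull_min (s := (fun j => Finsupp.single j (1:ℝ)) '' Ici m) (by
      rintro _ ⟨j, hj, rfl⟩
      simp only [mem_ofPred_eq, sub_zero]
      have h2 : eLpNorm (T (Finsupp.single j 1)) 2 (μ.withDensity (A m)) ^ 2 ≤ K m := by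
        rw [eLpNorm_two_withDensity_sq (hA m) (hT _)]
        refine (lintegral_mono fun x => ?_).trans ((hWK j).trans (hK hj))
        gcongr
        refine (iInf_le _ (j - m)).trans_eq ?_
        rw [Nat.sub_add_cancel hj]
      rw [one_div, ENNReal.le_rpow_inv_iff two_pos]
      simpa using h2) hconv
    have h3 := hsub (hc m)
    simp only [mem_ofPred_eq, sub_zero] at h3
    rw [one_div, ENNReal.le_rpow_inv_iff two_pos, ENNReal.rpow_ofNat,
      eLpNorm_two_withDensity_sq (hA m) (hT _)] at h3
    exact h3
  have hAlim : ∀ᵐ x ∂μ, Tendsto (fun m => A m x) atTop (𝓝 (Wlim x)) := by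
    filter_upwards [hWlim] with x hx
    have h1 : Monotone fun m => A m x := by
      intro m m' hmm
      refine le_iInf fun i => (iInf_le _ (i + m' - m)).trans_eq ?_
      have h : i + m' - m + m = i + m' := by
        have : m ≤ m' := hmm
        omega
      rw [h]
    have h2 := tendsto_atTop_iSup h1
    have h3 : ⨆ m, A m x = Wlim x := by rw [← hx.liminf_eq, liminf_eq_iSup_iInf_of_nat']
    rwa [h3] at h2
  calc ∫⁻ x, Wlim x * ‖g x‖ₑ ^ 2 ∂μ
      = ∫⁻ x, liminf (fun m => A m x * ‖T (c m) x‖ₑ ^ 2) atTop ∂μ := by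
        refine lintegral_congr_ae ?_
        filter_upwards [hAlim, hg] with x hx hgx
        refine (Tendsto.liminf_eq ?_).symm
        exact ENNReal.Tendsto.mul hx (Or.inr (by simp)) (ENNReal.Tendsto.pow hgx.enorm) (Or.inr (hWtop x))
    _ ≤ liminf (fun m => ∫⁻ x, A m x * ‖T (c m) x‖ₑ ^ 2 ∂μ) atTop :=
        lintegral_liminf_le' fun m => (hA m).aemeasurable.mul ((hT _).enorm.pow_const 2)
    _ ≤ liminf K atTop := liminf_le_liminf (Eventually.of_forall hAK)
    _ = S := hKS.liminf_eq

theorem le_lintegral_mul_enorm_sq_of_tendsto {α F : Type*} [MeasurableSpace α]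
    [NormedAddCommGroup F] {μ : Measure α} {W : ℕ → α → ENNReal} (hW : ∀ m, Measurable (W m))
    {M : NNReal} (hM : ∀ m, ∀ᵐ x ∂μ, W m x ≤ M) {Wlim : α → ENNReal}
    (hWlim : ∀ᵐ x ∂μ, Tendsto (fun m => W m x) atTop (𝓝 (Wlim x)))
    {G : ℕ → α → F} {g : α → F} (hG : ∀ m, AEStronglyMeasurable (G m) μ) (hg : MemLp g 2 μ)
    (hGg : Tendsto (fun m => eLpNorm (G m - g) 2 μ) atTop (𝓝 0))
    {L : ℕ → ENNReal} (hL : ∀ m, L m ≤ ∫⁻ x, W m x * ‖G m x‖ₑ ^ 2 ∂μ) {Llim : ENNReal}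
    (hLlim : Tendsto L atTop (𝓝 Llim)) :
    Llim ≤ ∫⁻ x, Wlim x * ‖g x‖ₑ ^ 2 ∂μ := by
  have htwo : ∀ f : α → F, eLpNorm f 2 μ ^ 2 = ∫⁻ x, ‖f x‖ₑ ^ 2 ∂μ := by
    intro f
    have h := eLpNorm_ofReal_rpow_eq_lintegral (μ := μ) f (q := 2) two_pos
    simpa only [ENNReal.ofReal_ofNat, ENNReal.rpow_ofNat] using h
  have hbound : ∀ m, L m ^ (1 / 2 : ℝ) ≤
      (M * eLpNorm (G m - g) 2 μ ^ 2) ^ (1 / 2 : ℝ) +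
        (∫⁻ x, W m x * ‖g x‖ₑ ^ 2 ∂μ) ^ (1 / 2 : ℝ) := by
    intro m
    have hac : μ.withDensity (W m) ≪ μ := withDensity_absolutelyContinuous _ _
    have hroot : ∀ t : ENNReal, (t ^ 2) ^ (1 / 2 : ℝ) = t := by
      intro t
      rw [← ENNReal.rpow_ofNat, ← ENNReal.rpow_mul]; norm_num
    have h1 := eLpNorm_add_le (μ := μ.withDensity (W m)) (p := 2)
      (((hG m).sub hg.1).mono_ac hac) (hg.1.mono_ac hac) (by norm_num)
    rw [sub_add_cancel] at h1
    rw [← hroot (eLpNorm (G m) _ _), ← hroot (eLpNorm (G m - g) _ _), ← hroot (eLpNorm g _ _),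
      eLpNorm_two_withDensity_sq (hW m) (hG m), eLpNorm_two_withDensity_sq (hW m) hg.1,
      eLpNorm_two_withDensity_sq (hW m) ((hG m).sub hg.1)] at h1
    refine (ENNReal.rpow_le_rpow (hL m) (by norm_num)).trans (h1.trans ?_)
    gcongr
    rw [htwo, ← lintegral_const_mul' _ _ (by simp)]
    refine lintegral_mono_ae ?_
    filter_upwards [hM m] with x hx
    gcongr
  have hdom : Tendsto (fun m => ∫⁻ x, W m x * ‖g x‖ₑ ^ 2 ∂μ) atTop
      (𝓝 (∫⁻ x, Wlim x * ‖g x‖ₑ ^ 2 ∂μ)) := by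
    refine tendsto_lintegral_of_dominated_convergence' (fun x => M * ‖g x‖ₑ ^ 2)
      (fun m => (hW m).aemeasurable.mul (hg.1.enorm.pow_const 2)) (fun m => ?_) ?_ ?_
    · filter_upwards [hM m] with x hx
      gcongr
    · rw [lintegral_const_mul' _ _ (by simp), ← htwo]
      exact ENNReal.mul_ne_top (by simp) (ENNReal.pow_ne_top hg.2.ne)
    · filter_upwards [hWlim] with x hx
      exact ENNReal.Tendsto.mul_const hx (Or.inr (by simp))
  have hz : Tendsto (fun m => (M * eLpNorm (G m - g) 2 μ ^ 2 : ENNReal) ^ (1 / 2 : ℝ)) atTop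
      (𝓝 0) := by
    have h1 : Tendsto (fun m => (M * eLpNorm (G m - g) 2 μ ^ 2 : ENNReal)) atTop (𝓝 0) := by
      simpa using ENNReal.Tendsto.const_mul (ENNReal.Tendsto.pow (n := 2) hGg) (Or.inr (by simp : (M : ENNReal) ≠ ⊤))
    simpa using h1.ennrpow_const (1 / 2 : ℝ)
  have hfin := le_of_tendsto_of_tendsto' (hLlim.ennrpow_const (1 / 2 : ℝ))
    (hz.add (hdom.ennrpow_const (1 / 2 : ℝ))) hbound
  rw [zero_add] at hfin
  exact (ENNReal.rpow_le_rpow_iff (by norm_num)).1 hfin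

section SmoothCompactSupport

variable {n : ℕ} {Ω : Set (EuclideanSpace ℝ (Fin n))} {u : EuclideanSpace ℝ (Fin n) → ℝ}

theorem norm_gradient_eq_norm_fderiv (u : EuclideanSpace ℝ (Fin n) → ℝ)
    (x : EuclideanSpace ℝ (Fin n)) : ‖gradient u x‖ = ‖fderiv ℝ u x‖ :=
  LinearIsometryEquiv.norm_map _ _

namespace smoothCpt

theorem differentiable (hu : smoothCpt n Ω u) : Differentiable ℝ u :=
  hu.1.differentiable (by simp)

theorem comp (hu : smoothCpt n Ω u) {f : ℝ → ℝ} (hf : ContDiff ℝ (⊤ : ℕ∞) f) (h0 : f 0 = 0) :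
    smoothCpt n Ω fun x => f (u x) :=
  ⟨hf.comp hu.1, hu.2.1.comp_left h0, (tsupport_comp_subset h0 u).trans hu.2.2⟩

theorem norm_gradient_comp_le (hu : smoothCpt n Ω u) {f f' : ℝ → ℝ}
    (hf : ∀ t, HasDerivAt f (f' t) t) (hf' : ∀ t, |f' t| ≤ 1) (x : EuclideanSpace ℝ (Fin n)) :
    ‖gradient (fun x => f (u x)) x‖ ≤ ‖gradient u x‖ := by
  rw [norm_gradient_eq_norm_fderiv, norm_gradient_eq_norm_fderiv]
  have h := (hf (u x)).comp_hasFDerivAt x (hu.differentiable x).hasFDerivAt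
  have h2 : fderiv ℝ (fun x => f (u x)) x = f' (u x) • fderiv ℝ u x := h.fderiv
  rw [h2, norm_smul]
  exact mul_le_of_le_one_left (norm_nonneg _) (hf' _)

theorem continuous_gradient (hu : smoothCpt n Ω u) : Continuous (gradient u) :=
  (LinearIsometryEquiv.continuous _).comp (hu.1.continuous_fderiv (by simp))

theorem hasCompactSupport_gradient (hu : smoothCpt n Ω u) : HasCompactSupport (gradient u) :=
  (hu.2.1.fderiv (𝕜 := ℝ)).comp_left (map_zero _)

theorem memLp (hu : smoothCpt n Ω u) (p : ENNReal) : MemLp u p (volume.restrict Ω) :=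
  (hu.1.continuous.memLp_of_hasCompactSupport hu.2.1).restrict Ω

theorem memLp_gradient (hu : smoothCpt n Ω u) (p : ENNReal) :
    MemLp (gradient u) p (volume.restrict Ω) :=
  (hu.continuous_gradient.memLp_of_hasCompactSupport hu.hasCompactSupport_gradient).restrict Ω

theorem gradient_add {v : EuclideanSpace ℝ (Fin n) → ℝ} (hu : smoothCpt n Ω u)
    (hv : smoothCpt n Ω v) : gradient (u + v) = gradient u + gradient v := by
  funext x
  simp only [gradient, Pi.add_apply]
  rw [fderiv_add (hu.differentiable x) (hv.differentiable x), map_add]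

theorem gradient_smul (hu : smoothCpt n Ω u) (a : ℝ) :
    gradient (a • u) = a • gradient u := by
  funext x
  simp only [gradient, Pi.smul_apply]
  rw [fderiv_const_smul (hu.differentiable x)]
  simp

theorem add {v : EuclideanSpace ℝ (Fin n) → ℝ} (hu : smoothCpt n Ω u)
    (hv : smoothCpt n Ω v) : smoothCpt n Ω (u + v) :=
  ⟨hu.1.add hv.1, hu.2.1.add hv.2.1, (tsupport_add u v).trans (union_subset hu.2.2 hv.2.2)⟩

theorem const_smul (hu : smoothCpt n Ω u) (a : ℝ) : smoothCpt n Ω (a • u) :=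
  hu.comp (f := fun t => a * t) (by fun_prop) (by simp)

theorem zero : smoothCpt n Ω 0 :=
  ⟨contDiff_const, HasCompactSupport.zero, by simp⟩

theorem integrable_energy (hu : smoothCpt n Ω u) {β k : ℝ} (hβ : 0 ≤ β) (hk : 0 ≤ k) :
    Integrable (fun x => (1 + ‖x‖ ^ β * |u x| ^ k) * ‖gradient u x‖ ^ 2)
      (volume.restrict Ω) := by
  refine Integrable.restrict (Continuous.integrable_of_hasCompactSupport ?_ ?_)
  · refine (continuous_const.add ((continuous_norm.rpow_const fun _ => Or.inr hβ).mul
      (hu.1.continuous.abs.rpow_const fun _ => Or.inr hk))).mul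
      (hu.continuous_gradient.norm.pow 2)
  · exact (hu.hasCompactSupport_gradient.comp_left (g := fun v => ‖v‖ ^ 2) (by simp)).mul_left

theorem ofReal_energy (hu : smoothCpt n Ω u) {β k : ℝ} (hβ : 0 ≤ β) (hk : 0 ≤ k) :
    ENNReal.ofReal (energy n Ω β k u) =
      ∫⁻ x in Ω, ENNReal.ofReal (1 + ‖x‖ ^ β * |u x| ^ k) * ‖gradient u x‖ₑ ^ 2 := by
  rw [energy, ofReal_integral_eq_lintegral_ofReal (hu.integrable_energy hβ hk)
    (Eventually.of_forall fun x => by positivity)]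
  refine lintegral_congr fun x => ?_
  rw [ENNReal.ofReal_mul (by positivity), ENNReal.ofReal_pow (norm_nonneg _), ofReal_norm]

end smoothCpt

/-- The space of smooth functions with compact support in `Ω`, as a submodule. -/
def smoothCptSubmodule (n : ℕ) (Ω : Set (EuclideanSpace ℝ (Fin n))) :
    Submodule ℝ (EuclideanSpace ℝ (Fin n) → ℝ) where
  carrier := {u | smoothCpt n Ω u}
  add_mem' hu hv := smoothCpt.add hu hv
  zero_mem' := smoothCpt.zero
  smul_mem' a _ hu := smoothCpt.const_smul hu a

/-- The gradient as a linear map on smooth functions with compact support. -/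
def gradientLinearMap (n : ℕ) (Ω : Set (EuclideanSpace ℝ (Fin n))) :
    smoothCptSubmodule n Ω →ₗ[ℝ] EuclideanSpace ℝ (Fin n) → EuclideanSpace ℝ (Fin n) where
  toFun u := gradient (u : EuclideanSpace ℝ (Fin n) → ℝ)
  map_add' u v := smoothCpt.gradient_add u.2 v.2
  map_smul' a u := smoothCpt.gradient_smul u.2 a

/-- The gradient as a linear map from smooth functions with compact support to `L²`. -/
def gradientLp (n : ℕ) (Ω : Set (EuclideanSpace ℝ (Fin n))) :
    smoothCptSubmodule n Ω →ₗ[ℝ] Lp (EuclideanSpace ℝ (Fin n)) 2 (volume.restrict Ω) where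
  toFun u := MemLp.toLp (gradientLinearMap n Ω u) (smoothCpt.memLp_gradient u.2 2)
  map_add' u v := (MemLp.toLp_congr _ ((smoothCpt.memLp_gradient u.2 2).add
    (smoothCpt.memLp_gradient v.2 2)) (by rw [map_add]; rfl)).trans (MemLp.toLp_add _ _)
  map_smul' a u := (MemLp.toLp_congr _ ((smoothCpt.memLp_gradient u.2 2).const_smul a)
    (by rw [map_smul]; rfl)).trans (MemLp.toLp_const_smul _ _)

theorem energy_nonneg (β k : ℝ) (u : EuclideanSpace ℝ (Fin n) → ℝ) : 0 ≤ energy n Ω β k u :=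
  integral_nonneg fun x => by positivity

theorem Sw_nonneg (β k q : ℝ) : 0 ≤ Sw n Ω β k q :=
  Real.sInf_nonneg (by rintro _ ⟨u, -, -, rfl⟩; exact energy_nonneg β k u)

theorem ofReal_integral_norm_rpow {α F : Type*} [MeasurableSpace α] [NormedAddCommGroup F]
    {μ : Measure α} {f : α → F} {q : ℝ} (hq : 0 < q) (hf : MemLp f (ENNReal.ofReal q) μ) :
    ENNReal.ofReal (∫ x, ‖f x‖ ^ q ∂μ) = eLpNorm f (ENNReal.ofReal q) μ ^ q := by
  have hint := hf.integrable_norm_rpow (by simpa using hq) (by simp)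
  rw [ENNReal.toReal_ofReal hq.le] at hint
  rw [eLpNorm_ofReal_rpow_eq_lintegral f hq, ofReal_integral_eq_lintegral_ofReal hint
    (Eventually.of_forall fun x => by positivity)]
  refine lintegral_congr fun x => ?_
  rw [← ENNReal.ofReal_rpow_of_nonneg (norm_nonneg _) hq.le, ofReal_norm]

theorem tendsto_integral_norm_rpow_zero {α F : Type*} [MeasurableSpace α] [NormedAddCommGroup F]
    {μ : Measure α} {f : ℕ → α → F} {q : ℝ} (hq : 0 < q)
    (hf : ∀ j, MemLp (f j) (ENNReal.ofReal q) μ)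
    (h : Tendsto (fun j => eLpNorm (f j) (ENNReal.ofReal q) μ) atTop (𝓝 0)) :
    Tendsto (fun j => ∫ x, ‖f j x‖ ^ q ∂μ) atTop (𝓝 0) := by
  have h1 : Tendsto (fun j => ENNReal.ofReal (∫ x, ‖f j x‖ ^ q ∂μ)) atTop (𝓝 0) := by
    simp only [ofReal_integral_norm_rpow hq (hf _)]
    simpa [hq] using h.ennrpow_const q
  refine ((ENNReal.tendsto_toReal ENNReal.zero_ne_top).comp h1).congr fun j => ?_
  exact ENNReal.toReal_ofReal (integral_nonneg fun x => by positivity)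

theorem Sw_le_energy {β k q : ℝ} (hu : smoothCpt n Ω u) (h1 : ∫ x in Ω, |u x| ^ q = 1) :
    Sw n Ω β k q ≤ energy n Ω β k u :=
  csInf_le ⟨0, by rintro _ ⟨u, -, -, rfl⟩; exact energy_nonneg β k u⟩ ⟨u, hu, h1, rfl⟩

theorem integral_abs_smul_rpow_eq_one {q : ℝ} {μ : Measure (EuclideanSpace ℝ (Fin n))}
    {r : ℝ} (hr : 0 < r) (h : ∫ x, |u x| ^ q ∂μ = r ^ q) :
    ∫ x, |(r⁻¹ • u) x| ^ q ∂μ = 1 := by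
  have : ∀ x, |(r⁻¹ • u) x| ^ q = (r ^ q)⁻¹ * |u x| ^ q := by
    intro x
    rw [Pi.smul_apply, smul_eq_mul, abs_mul, abs_of_pos (inv_pos.2 hr),
      Real.mul_rpow (inv_pos.2 hr).le (abs_nonneg _), Real.inv_rpow hr.le]
  simp only [this]
  rw [integral_const_mul, h, inv_mul_cancel₀ (Real.rpow_pos_of_pos hr q).ne']

theorem min_mul_sq_mul_Sw_le_energy {β k q : ℝ} (hβ : 0 ≤ β) (hk : 0 < k)
    (hu : smoothCpt n Ω u) {r : ℝ} (hr : 0 ≤ r)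
    (h : ∫ x in Ω, |u x| ^ q = r ^ q) :
    min 1 (r ^ k) * r ^ 2 * Sw n Ω β k q ≤ energy n Ω β k u := by
  rcases hr.eq_or_lt with rfl | hr
  · simpa using energy_nonneg β k u
  have hS := Sw_le_energy (β := β) (k := k) (hu.const_smul r⁻¹)
    (integral_abs_smul_rpow_eq_one hr h)
  have hm : 0 ≤ min 1 (r ^ k) := le_min zero_le_one (by positivity)
  refine (mul_le_mul_of_nonneg_left hS (by positivity)).trans ?_
  rw [energy, energy, ← integral_const_mul]
  refine integral_mono (((hu.const_smul r⁻¹).integrable_energy hβ hk.le).const_mul _)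
    (hu.integrable_energy hβ hk.le) fun x => ?_
  simp only [hu.gradient_smul, Pi.smul_apply, smul_eq_mul, norm_smul, norm_inv,
    Real.norm_eq_abs, abs_mul, abs_inv, abs_of_pos hr, mul_pow, inv_pow]
  rw [Real.mul_rpow (by positivity) (abs_nonneg _), Real.inv_rpow hr.le]
  have hrk : 0 < r ^ k := by positivity
  have h1 : min 1 (r ^ k) * (1 + ‖x‖ ^ β * ((r ^ k)⁻¹ * |u x| ^ k)) ≤
      1 + ‖x‖ ^ β * |u x| ^ k := by
    have ha : 0 ≤ ‖x‖ ^ β * |u x| ^ k := by positivity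
    have hb : min 1 (r ^ k) * (r ^ k)⁻¹ ≤ 1 := by
      rw [← div_eq_mul_inv, div_le_one hrk]; exact min_le_right _ _
    have hc : min 1 (r ^ k) ≤ 1 := min_le_left _ _
    nlinarith [mul_le_mul_of_nonneg_right hb ha]
  calc _ = min 1 (r ^ k) * (1 + ‖x‖ ^ β * ((r ^ k)⁻¹ * |u x| ^ k)) * ‖gradient u x‖ ^ 2 := by
        field_simp
    _ ≤ _ := by gcongr

theorem exists_smoothCpt_integral_eq_one (hΩ : IsOpen Ω) (h0 : 0 ∈ Ω) {q : ℝ} (hq : 0 < q) :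
    ∃ u, smoothCpt n Ω u ∧ ∫ x in Ω, |u x| ^ q = 1 := by
  obtain ⟨ε, hε, hball⟩ := Metric.isOpen_iff.1 hΩ 0 h0
  let f : ContDiffBump (0 : EuclideanSpace ℝ (Fin n)) := ⟨ε / 4, ε / 2, by positivity, by linarith⟩
  have hf : smoothCpt n Ω f := by
    refine ⟨f.contDiff, f.hasCompactSupport, ?_⟩
    rw [f.tsupport_eq]
    exact (Metric.closedBall_subset_ball (by simp only [f]; linarith)).trans hball
  have hpos : 0 < ∫ x in Ω, |f x| ^ q := by
    have hsub : Metric.ball (0 : EuclideanSpace ℝ (Fin n)) (ε / 2) ⊆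
        Function.support fun x => |f x| ^ q := by
      intro x hx
      have : 0 < f x := f.pos_of_mem_ball hx
      simp only [Function.mem_support]
      positivity
    have hint := (hf.memLp (ENNReal.ofReal q)).integrable_norm_rpow (by simpa using hq) (by simp)
    rw [ENNReal.toReal_ofReal hq.le] at hint
    simp only [Real.norm_eq_abs] at hint
    rw [integral_pos_iff_support_of_nonneg (fun x => by positivity) hint]
    refine lt_of_lt_of_le ?_ (measure_mono hsub)
    rw [Measure.restrict_apply Metric.isOpen_ball.measurableSet,
      inter_eq_left.2 ((Metric.ball_subset_ball (by linarith)).trans hball)]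
    exact Metric.measure_ball_pos _ _ (by positivity)
  set I := ∫ x in Ω, |f x| ^ q
  refine ⟨_, hf.const_smul (I ^ q⁻¹)⁻¹, integral_abs_smul_rpow_eq_one (by positivity) ?_⟩
  rw [← Real.rpow_mul hpos.le, inv_mul_cancel₀ hq.ne', Real.rpow_one]

end SmoothCompactSupport

section Minimization

variable {n : ℕ} {Ω : Set (EuclideanSpace ℝ (Fin n))}

theorem energy_comp_le {u : EuclideanSpace ℝ (Fin n) → ℝ} (hu : smoothCpt n Ω u) {β k : ℝ}
    (hβ : 0 ≤ β) (hk : 0 ≤ k) {f f' : ℝ → ℝ} (hfc : ContDiff ℝ (⊤ : ℕ∞) f)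
    (hf : ∀ t, HasDerivAt f (f' t) t) (hf' : ∀ t, |f' t| ≤ 1) (hft : ∀ t, |f t| ≤ |t|) :
    energy n Ω β k (fun x => f (u x)) ≤ energy n Ω β k u := by
  have h0 : f 0 = 0 := by simpa using hft 0
  refine integral_mono ((hu.comp hfc h0).integrable_energy hβ hk) (hu.integrable_energy hβ hk)
    fun x => ?_
  have h1 := hu.norm_gradient_comp_le hf hf' x
  have h2 := hft (u x)
  dsimp only
  gcongr

theorem exists_nonneg_energy_le (hΩo : IsOpen Ω) (hΩb : Bornology.IsBounded Ω) (h0 : 0 ∈ Ω)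
    {q : ℝ} (hq : 1 ≤ q) {β k : ℝ} (hβ : 0 ≤ β) (hk : 0 ≤ k) {δ : ℝ} (hδ : 0 < δ) :
    ∃ w, smoothCpt n Ω w ∧ (∀ x, 0 ≤ w x) ∧ energy n Ω β k w ≤ Sw n Ω β k q + δ ∧
      eLpNorm w (ENNReal.ofReal q) (volume.restrict Ω) ≤ 1 ∧
      1 ≤ eLpNorm w (ENNReal.ofReal q) (volume.restrict Ω) + ENNReal.ofReal δ := by
  have hq0 : 0 < q := by linarith
  obtain ⟨u₀, hu₀, hu₀1⟩ := exists_smoothCpt_integral_eq_one hΩo h0 hq0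
  obtain ⟨_, ⟨u, hu, hu1, rfl⟩, hlt⟩ := exists_lt_of_csInf_lt (b := Sw n Ω β k q + δ)
    (s := {c | ∃ u, smoothCpt n Ω u ∧ (∫ x in Ω, |u x| ^ q) = 1 ∧ c = energy n Ω β k u})
    ⟨_, u₀, hu₀, hu₀1, rfl⟩ (lt_add_of_pos_right _ hδ)
  have hfin : IsFiniteMeasure (volume.restrict Ω) :=
    isFiniteMeasure_restrict.2 hΩb.measure_lt_top.ne
  set c : ENNReal := volume.restrict Ω univ ^ q⁻¹ with hc
  have hctop : c ≠ ⊤ := ENNReal.rpow_ne_top_of_nonneg (by positivity) (measure_ne_top _ _)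
  set ε := δ / (c.toReal + 1)
  have hcR : 0 ≤ c.toReal := ENNReal.toReal_nonneg
  have hε : 0 < ε := by positivity
  set f : ℝ → ℝ := fun t => √(t ^ 2 + ε ^ 2) - ε with hf_def
  have hpos : ∀ t : ℝ, 0 < t ^ 2 + ε ^ 2 := fun t => by positivity
  have hfc : ContDiff ℝ (⊤ : ℕ∞) f :=
    (ContDiff.sqrt (by fun_prop) fun t => (hpos t).ne').sub contDiff_const
  have hfd : ∀ t, HasDerivAt f (t / √(t ^ 2 + ε ^ 2)) t := by
    intro t
    have h := (((hasDerivAt_pow 2 t).add_const (ε ^ 2)).sqrt (hpos t).ne').sub_const ε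
    refine h.congr_deriv ?_
    have := Real.sqrt_pos.2 (hpos t)
    field_simp
    simp
  have hsq : ∀ t : ℝ, |t| ≤ √(t ^ 2 + ε ^ 2) := fun t =>
    Real.abs_le_sqrt (by nlinarith [sq_nonneg ε])
  have hsq2 : ∀ t : ℝ, √(t ^ 2 + ε ^ 2) ≤ |t| + ε := fun t => by
    rw [Real.sqrt_le_left (by positivity)]
    nlinarith [sq_abs t, mul_nonneg (abs_nonneg t) hε.le]
  have hfd' : ∀ t : ℝ, |t / √(t ^ 2 + ε ^ 2)| ≤ 1 := fun t => by
    rw [abs_div, abs_of_pos (Real.sqrt_pos.2 (hpos t)), div_le_one (Real.sqrt_pos.2 (hpos t))]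
    exact hsq t
  have hf0 : ∀ t, 0 ≤ f t := fun t => by
    have : ε ≤ √(t ^ 2 + ε ^ 2) := Real.le_sqrt_of_sq_le (by nlinarith [sq_nonneg t])
    simp only [f]; linarith
  have hft : ∀ t, |f t| ≤ |t| := fun t => by
    rw [abs_of_nonneg (hf0 t)]
    have := hsq2 t
    simp only [f]; linarith
  have hw := hu.comp hfc (by simpa using hft 0)
  have hnorm : eLpNorm u (ENNReal.ofReal q) (volume.restrict Ω) = 1 := by
    have h := ofReal_integral_norm_rpow hq0 (hu.memLp (ENNReal.ofReal q))
    simp only [Real.norm_eq_abs] at h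
    rw [hu1, ENNReal.ofReal_one] at h
    rw [← ENNReal.rpow_rpow_inv hq0.ne' (eLpNorm u _ _), ← h, ENNReal.one_rpow]
  refine ⟨fun x => f (u x), hw, fun x => hf0 _,
    (energy_comp_le hu hβ hk hfc hfd hfd' hft).trans hlt.le, ?_, ?_⟩
  · rw [← hnorm]
    exact eLpNorm_mono fun x => by simpa using hft (u x)
  · have h1 : eLpNorm (fun x => |u x| - f (u x)) (ENNReal.ofReal q) (volume.restrict Ω) ≤
        ENNReal.ofReal δ := by
      refine (eLpNorm_le_of_ae_bound (C := ε) (Eventually.of_forall fun x => ?_)).trans ?_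
      · have h3 := hsq (u x)
        have h4 := hft (u x)
        rw [abs_of_nonneg (hf0 _)] at h4
        rw [Real.norm_eq_abs, abs_le]
        simp only [f] at h4 ⊢
        constructor <;> linarith
      · rw [ENNReal.toReal_ofReal hq0.le, ← hc, ← ENNReal.ofReal_toReal hctop,
          ← ENNReal.ofReal_mul hcR]
        refine ENNReal.ofReal_le_ofReal ?_
        simp only [ε]
        rw [← mul_div_assoc, div_le_iff₀ (by positivity)]
        nlinarith
    have h2 := eLpNorm_add_le (μ := volume.restrict Ω) (p := ENNReal.ofReal q)
      (hw.memLp 1).1 ((hu.memLp 1).norm.1.sub (hw.memLp 1).1) (by simpa using hq)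
    rw [add_sub_cancel, eLpNorm_norm, hnorm] at h2
    exact h2.trans (add_le_add le_rfl h1)

end Minimization

section Minimization

variable {n : ℕ} {Ω : Set (EuclideanSpace ℝ (Fin n))}

theorem tendsto_mul_sin_div (t : ℝ) :
    Tendsto (fun N : ℕ => ((N : ℝ) + 1) * Real.sin (t / (N + 1))) atTop (𝓝 t) := by
  rcases eq_or_ne t 0 with rfl | ht
  · simp
  have h1 : Tendsto (fun N : ℕ => t / ((N : ℝ) + 1)) atTop (𝓝 0) :=
    tendsto_const_nhds.div_atTop (tendsto_atTop_add_const_right _ _ tendsto_natCast_atTop_atTop)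
  have h2 := ((Real.continuous_sinc.tendsto 0).comp h1).const_mul t
  rw [Real.sinc_zero, mul_one] at h2
  refine h2.congr fun N => ?_
  have hN : (0 : ℝ) < N + 1 := by positivity
  rw [Function.comp_apply, Real.sinc_of_ne_zero (by positivity)]
  field_simp

theorem abs_mul_sin_div_le {R : ℝ} (hR : 0 < R) (t : ℝ) : |R * Real.sin (t / R)| ≤ |t| := by
  rw [abs_mul, abs_of_pos hR]
  calc R * |Real.sin (t / R)| ≤ R * |t / R| := mul_le_mul_of_nonneg_left Real.abs_sin_le_abs hR.le
    _ = |t| := by rw [abs_div, abs_of_pos hR]; field_simp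

theorem abs_mul_sin_le {R : ℝ} (hR : 0 < R) (t : ℝ) : |R * Real.sin t| ≤ R := by
  rw [abs_mul, abs_of_pos hR]
  exact mul_le_of_le_one_right hR.le (Real.abs_sin_le_one _)

theorem normalized_energy_le_lintegral_of_bounded (hΩo : IsOpen Ω) (hΩb : Bornology.IsBounded Ω)
    {q β k : ℝ} (hq : 0 < q) (hβ : 0 ≤ β) (hk : 0 < k)
    {φ : ℕ → EuclideanSpace ℝ (Fin n) → ℝ} (hφ : ∀ j, smoothCpt n Ω (φ j))
    {u : EuclideanSpace ℝ (Fin n) → ℝ}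
    (hφu : ∀ᵐ x ∂volume.restrict Ω, Tendsto (fun j => φ j x) atTop (𝓝 (u x)))
    {g : EuclideanSpace ℝ (Fin n) → EuclideanSpace ℝ (Fin n)}
    (hg : MemLp g 2 (volume.restrict Ω))
    (hφg : Tendsto (fun j => eLpNorm (gradient (φ j) - g) 2 (volume.restrict Ω)) atTop (𝓝 0))
    {f f' : ℝ → ℝ} (hfc : ContDiff ℝ (⊤ : ℕ∞) f) (hfd : ∀ t, HasDerivAt f (f' t) t)
    (hf' : ∀ t, |f' t| ≤ 1) (hf0 : f 0 = 0) {R : ℝ} (hfR : ∀ t, |f t| ≤ R)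
    {F : ℝ → ENNReal} (hF : Continuous F)
    (hFe : ∀ ψ, smoothCpt n Ω ψ →
      F (∫ x in Ω, |ψ x| ^ q) ≤ ENNReal.ofReal (energy n Ω β k ψ)) :
    F (∫ x in Ω, |f (u x)| ^ q) ≤
      ∫⁻ x in Ω, ENNReal.ofReal (1 + ‖x‖ ^ β * |f (u x)| ^ k) * ‖g x‖ₑ ^ 2 := by
  have hfin : IsFiniteMeasure (volume.restrict Ω) :=
    isFiniteMeasure_restrict.2 hΩb.measure_lt_top.ne
  obtain ⟨D, hD⟩ := hΩb.exists_norm_le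
  have hfcont : Continuous f := hfc.continuous
  refine le_lintegral_mul_enorm_sq_of_tendsto (μ := volume.restrict Ω)
    (W := fun j x => ENNReal.ofReal (1 + ‖x‖ ^ β * |f (φ j x)| ^ k))
    (Wlim := fun x => ENNReal.ofReal (1 + ‖x‖ ^ β * |f (u x)| ^ k))
    (M := (1 + D ^ β * R ^ k).toNNReal)
    (G := fun j => gradient (φ j)) (g := g)
    (L := fun j => F (∫ x in Ω, |f (φ j x)| ^ q))
    (Llim := F (∫ x in Ω, |f (u x)| ^ q)) (fun j => ?_) (fun j => ?_) ?_
    (fun j => (hφ j).continuous_gradient.aestronglyMeasurable) hg hφg (fun j => ?_) ?_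
  · exact (((measurable_norm.pow_const β).mul
      ((hfcont.measurable.comp (hφ j).1.continuous.measurable).abs.pow_const k)).const_add
        1).ennreal_ofReal
  · filter_upwards [ae_restrict_mem hΩo.measurableSet] with x hx
    refine ENNReal.ofReal_le_ofReal ?_
    have h1 : ‖x‖ ^ β ≤ D ^ β := Real.rpow_le_rpow (norm_nonneg _) (hD x hx) hβ
    have h2 : |f (φ j x)| ^ k ≤ R ^ k := Real.rpow_le_rpow (abs_nonneg _) (hfR _) hk.le
    have h3 : 0 ≤ ‖x‖ ^ β := by positivity
    have h4 : 0 ≤ |f (φ j x)| ^ k := by positivity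
    nlinarith [mul_le_mul h1 h2 h4 (h3.trans h1)]
  · filter_upwards [hφu] with x hx
    refine ENNReal.tendsto_ofReal (tendsto_const_nhds.add (tendsto_const_nhds.mul ?_))
    exact (((hfcont.tendsto _).comp hx).abs).rpow_const (Or.inr hk.le)
  · have hψ := (hφ j).comp hfc hf0
    refine (hFe _ hψ).trans ?_
    rw [hψ.ofReal_energy hβ hk.le]
    refine lintegral_mono fun x => ?_
    gcongr
    rw [← ofReal_norm, ← ofReal_norm]
    exact ENNReal.ofReal_le_ofReal ((hφ j).norm_gradient_comp_le hfd hf' x)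
  · refine (hF.tendsto _).comp (tendsto_integral_of_dominated_convergence (fun _ => R ^ q)
      (fun j => ?_) (integrable_const _) (fun j => Eventually.of_forall fun x => ?_) ?_)
    · exact ((hfcont.comp (hφ j).1.continuous).abs.rpow_const
        fun _ => Or.inr hq.le).aestronglyMeasurable
    · rw [Real.norm_of_nonneg (by positivity)]
      exact Real.rpow_le_rpow (abs_nonneg _) (hfR _) hq.le
    · filter_upwards [hφu] with x hx
      exact (((hfcont.tendsto _).comp hx).abs).rpow_const (Or.inr hq.le)

theorem ofReal_Sw_le_lintegral (hΩo : IsOpen Ω) (hΩb : Bornology.IsBounded Ω) {q β k : ℝ}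
    (hq : 0 < q) (hβ : 0 ≤ β) (hk : 0 < k) {φ : ℕ → EuclideanSpace ℝ (Fin n) → ℝ}
    (hφ : ∀ j, smoothCpt n Ω (φ j)) {u : EuclideanSpace ℝ (Fin n) → ℝ}
    (hu : MemLp u (ENNReal.ofReal q) (volume.restrict Ω))
    (hu1 : ∫ x in Ω, |u x| ^ q = 1)
    (hφu : ∀ᵐ x ∂volume.restrict Ω, Tendsto (fun j => φ j x) atTop (𝓝 (u x)))
    {g : EuclideanSpace ℝ (Fin n) → EuclideanSpace ℝ (Fin n)}
    (hg : MemLp g 2 (volume.restrict Ω))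
    (hφg : Tendsto (fun j => eLpNorm (gradient (φ j) - g) 2 (volume.restrict Ω)) atTop (𝓝 0)) :
    ENNReal.ofReal (Sw n Ω β k q) ≤
      ∫⁻ x in Ω, ENNReal.ofReal (1 + ‖x‖ ^ β * |u x| ^ k) * ‖g x‖ₑ ^ 2 := by
  set S := Sw n Ω β k q
  set F : ℝ → ENNReal := fun I =>
    ENNReal.ofReal (min 1 ((I ^ q⁻¹) ^ k) * (I ^ q⁻¹) ^ 2 * S) with hF_def
  have hF : Continuous F := by
    have h1 : Continuous fun I : ℝ => I ^ q⁻¹ :=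
      continuous_id.rpow_const fun _ => Or.inr (inv_pos.2 hq).le
    exact ENNReal.continuous_ofReal.comp (((continuous_const.min
      (h1.rpow_const fun _ => Or.inr hk.le)).mul (h1.pow 2)).mul continuous_const)
  have hmain : ∀ N : ℕ, F (∫ x in Ω, |((N : ℝ) + 1) * Real.sin (u x / (N + 1))| ^ q) ≤
      ∫⁻ x in Ω, ENNReal.ofReal (1 + ‖x‖ ^ β * |u x| ^ k) * ‖g x‖ₑ ^ 2 := by
    intro N
    have hR : (0 : ℝ) < N + 1 := by positivity
    refine (normalized_energy_le_lintegral_of_bounded hΩo hΩb hq hβ hk hφ hφu hg hφg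
      (f := fun t => ((N : ℝ) + 1) * Real.sin (t / (N + 1)))
      (f' := fun t => Real.cos (t / ((N : ℝ) + 1)))
      (contDiff_const.mul (Real.contDiff_sin.comp (contDiff_id.div_const _))) (fun t => ?_)
      (fun t => Real.abs_cos_le_one _) (by simp) (fun t => abs_mul_sin_le hR _) hF
      fun ψ hψ => ?_).trans (lintegral_mono fun x => ?_)
    · have h := ((Real.hasDerivAt_sin (t / ((N : ℝ) + 1))).comp t
        ((hasDerivAt_id t).div_const ((N : ℝ) + 1))).const_mul ((N : ℝ) + 1)
      refine h.congr_deriv ?_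
      field_simp
    · have hI : 0 ≤ ∫ x in Ω, |ψ x| ^ q := integral_nonneg fun x => by positivity
      exact ENNReal.ofReal_le_ofReal (min_mul_sq_mul_Sw_le_energy (q := q) hβ hk hψ
        (r := (∫ x in Ω, |ψ x| ^ q) ^ q⁻¹) (by positivity) (Real.rpow_inv_rpow hI hq.ne').symm)
    · have := abs_mul_sin_div_le hR (u x)
      dsimp only
      gcongr
  have hint := hu.integrable_norm_rpow (by simpa using hq) (by simp)
  rw [ENNReal.toReal_ofReal hq.le] at hint
  simp only [Real.norm_eq_abs] at hint
  have hlim : Tendsto (fun N : ℕ => ∫ x in Ω, |((N : ℝ) + 1) * Real.sin (u x / (N + 1))| ^ q)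
      atTop (𝓝 (∫ x in Ω, |u x| ^ q)) := by
    refine tendsto_integral_of_dominated_convergence (fun x => |u x| ^ q) (fun N => ?_) hint
      (fun N => Eventually.of_forall fun x => ?_) (Eventually.of_forall fun x => ?_)
    · have hc : Continuous fun t : ℝ => |((N : ℝ) + 1) * Real.sin (t / (N + 1))| ^ q :=
        Continuous.rpow_const (by fun_prop) fun _ => Or.inr hq.le
      exact hc.comp_aestronglyMeasurable hu.1
    · rw [Real.norm_of_nonneg (by positivity)]
      exact Real.rpow_le_rpow (abs_nonneg _) (abs_mul_sin_div_le (by positivity) _) hq.le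
    · exact (tendsto_mul_sin_div (u x)).abs.rpow_const (Or.inr hq.le)
  rw [hu1] at hlim
  have h := le_of_tendsto' ((hF.tendsto 1).comp hlim) hmain
  simpa [F] using h

theorem eLpNorm_two_le_of_lintegral_le {α F : Type*} [MeasurableSpace α] [NormedAddCommGroup F]
    {μ : Measure α} {f : α → F} {K : ENNReal} (hf : ∫⁻ x, ‖f x‖ₑ ^ 2 ∂μ ≤ K) :
    eLpNorm f 2 μ ≤ K ^ (2⁻¹ : ℝ) := by
  have h := eLpNorm_ofReal_rpow_eq_lintegral (μ := μ) f (q := 2) two_pos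
  simp only [ENNReal.ofReal_ofNat, ENNReal.rpow_ofNat] at h
  rw [ENNReal.le_rpow_inv_iff two_pos, ENNReal.rpow_ofNat, h]
  exact hf

theorem eLpNorm_gradient_le_of_energy_le {u : EuclideanSpace ℝ (Fin n) → ℝ}
    (hu : smoothCpt n Ω u) {β k : ℝ} (hβ : 0 ≤ β) (hk : 0 ≤ k) {K : ℝ}
    (hK : energy n Ω β k u ≤ K) :
    eLpNorm (gradient u) 2 (volume.restrict Ω) ≤ ENNReal.ofReal K ^ (2⁻¹ : ℝ) := by
  refine eLpNorm_two_le_of_lintegral_le (le_trans ?_ (ENNReal.ofReal_le_ofReal hK))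
  rw [hu.ofReal_energy hβ hk]
  refine lintegral_mono fun x => le_mul_of_one_le_left zero_le ?_
  rw [ENNReal.one_le_ofReal]
  have : 0 ≤ ‖x‖ ^ β * |u x| ^ k := by positivity
  linarith

theorem exists_subseq_tendsto_eLpNorm (hn : 3 ≤ n) {q : ℝ} (hq : q = 2 * n / (n - 2))
    (hΩb : Bornology.IsBounded Ω) {β k : ℝ} (hk0 : 0 < k) (hkq : k ≤ q) (hβ0 : 0 ≤ β)
    (hβ : β < k * n / q) {w : ℕ → EuclideanSpace ℝ (Fin n) → ℝ} (hw : ∀ j, smoothCpt n Ω (w j))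
    (hw1 : ∀ j, eLpNorm (w j) (ENNReal.ofReal q) (volume.restrict Ω) ≤ 1) {K : ℝ}
    (hK : ∀ j, energy n Ω β k (w j) ≤ K) :
    ∃ σ : ℕ → ℕ, StrictMono σ ∧ ∃ u : EuclideanSpace ℝ (Fin n) → ℝ,
      MemLp u (ENNReal.ofReal q) (volume.restrict Ω) ∧
      Tendsto (fun j => eLpNorm (w (σ j) - u) (ENNReal.ofReal q) (volume.restrict Ω))
        atTop (𝓝 0) := by
  have hfin : IsFiniteMeasure (volume.restrict Ω) :=
    isFiniteMeasure_restrict.2 hΩb.measure_lt_top.ne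
  have hn' : (3 : ℝ) ≤ n := by exact_mod_cast hn
  have hq2 : 2 < q := by
    rw [hq, lt_div_iff₀ (by linarith)]; linarith
  set b : ENNReal := ENNReal.ofReal K ^ (2⁻¹ : ℝ)
  have hb : b ≠ ⊤ := ENNReal.rpow_ne_top_of_nonneg (by norm_num) (by simp)
  have hsup : ∀ j, Function.support (w j) ⊆ Ω := fun j =>
    (subset_tsupport _).trans (hw j).2.2
  have hsupg : ∀ j x, x ∉ Ω → fderiv ℝ (w j) x = 0 := fun j x hx => by
    by_contra h
    exact hx ((hw j).2.2 (support_fderiv_subset ℝ h))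
  have henergy : ∀ j, ∫⁻ x in Ω,
      ENNReal.ofReal (1 + ‖x‖ ^ β * |w j x| ^ k) * ‖gradient (w j) x‖ₑ ^ 2 ≤ ENNReal.ofReal K := by
    intro j
    rw [← (hw j).ofReal_energy hβ0 hk0.le]
    exact ENNReal.ofReal_le_ofReal (hK j)
  have hweight : ∀ j, eLpNorm (fun x => ‖x‖ ^ (β / 2) * |w j x| ^ (k / 2) * ‖fderiv ℝ (w j) x‖) 2
      volume ≤ b := by
    intro j
    rw [← eLpNorm_restrict_eq_of_support_subset (s := Ω)]
    · refine eLpNorm_two_le_of_lintegral_le ((lintegral_mono fun x => ?_).trans (henergy j))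
      dsimp only
      rw [← norm_gradient_eq_norm_fderiv, enorm_mul, mul_pow, enorm_norm]
      gcongr
      rw [Real.enorm_of_nonneg (by positivity), ← ENNReal.ofReal_pow (by positivity)]
      refine ENNReal.ofReal_le_ofReal ?_
      have h1 : (‖x‖ ^ (β / 2)) ^ 2 = ‖x‖ ^ β := by
        rw [← Real.rpow_natCast, ← Real.rpow_mul (norm_nonneg _)]; norm_num
      have h2 : (|w j x| ^ (k / 2)) ^ 2 = |w j x| ^ k := by
        rw [← Real.rpow_natCast, ← Real.rpow_mul (abs_nonneg _)]; norm_num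
      rw [mul_pow, h1, h2]
      linarith
    · intro x hx
      by_contra hxΩ
      exact hx (by simp [hsupg j x hxΩ])
  obtain ⟨s, hs, C, hC⟩ := exists_eLpNorm_rpow_le_weighted volume (by simp) hn hq hΩb hk0 hkq
    hβ0 hβ
  have hLs : ∀ j, eLpNorm (w j) (ENNReal.ofReal s) (volume.restrict Ω) ≤
      (C * b) ^ (1 + k / 2)⁻¹ := by
    intro j
    rw [ENNReal.le_rpow_inv_iff (by positivity)]
    calc _ ≤ eLpNorm (w j) (ENNReal.ofReal s) volume ^ (1 + k / 2) := by
          gcongr; exact Measure.restrict_le_self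
      _ ≤ _ := hC _ ((hw j).1.of_le (by simp)) (hw j).2.1 (hw j).2.2
      _ ≤ C * b := by gcongr; exact hweight j
  have hCtop : (C * b : ENNReal) ^ (1 + k / 2)⁻¹ ≠ ⊤ :=
    ENNReal.rpow_ne_top_of_nonneg (by positivity) (ENNReal.mul_ne_top (by simp) hb)
  set a : ENNReal := volume.restrict Ω univ ^ ((2 : ℝ)⁻¹ - q⁻¹)
  have ha : a ≠ ⊤ := by
    refine ENNReal.rpow_ne_top_of_nonneg ?_ (measure_ne_top _ _)
    have := inv_anti₀ two_pos hq2.le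
    linarith
  have hL2 : ∀ j, eLpNorm (w j) 2 volume ≤ a.toNNReal := by
    intro j
    rw [← eLpNorm_restrict_eq_of_support_subset (hsup j), ENNReal.coe_toNNReal ha]
    refine (eLpNorm_le_eLpNorm_mul_rpow_measure_univ (q := ENNReal.ofReal q) ?_
      ((hw j).memLp 1).1).trans ?_
    · rw [← ENNReal.ofReal_ofNat]
      exact ENNReal.ofReal_le_ofReal hq2.le
    · rw [ENNReal.toReal_ofReal (by linarith)]
      simp only [ENNReal.toReal_ofNat, one_div]
      exact mul_le_of_le_one_left zero_le (hw1 j)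
  set d : ENNReal := b * volume.restrict Ω univ ^ (2⁻¹ : ℝ)
  have hd : d ≠ ⊤ := ENNReal.mul_ne_top hb
    (ENNReal.rpow_ne_top_of_nonneg (by norm_num) (measure_ne_top _ _))
  have hL1 : ∀ j, ∫⁻ x, ‖fderiv ℝ (w j) x‖ₑ ≤ d.toNNReal := by
    intro j
    rw [ENNReal.coe_toNNReal hd]
    have h1 : ∫⁻ x, ‖fderiv ℝ (w j) x‖ₑ = eLpNorm (gradient (w j)) 1 volume := by
      rw [eLpNorm_one_eq_lintegral_enorm]
      refine lintegral_congr fun x => ?_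
      rw [← ofReal_norm, ← ofReal_norm, norm_gradient_eq_norm_fderiv]
    rw [h1, ← eLpNorm_restrict_eq_of_support_subset (s := Ω)]
    · refine (eLpNorm_le_eLpNorm_mul_rpow_measure_univ (q := 2) (by norm_num)
        ((hw j).memLp_gradient 1).1).trans ?_
      exact mul_le_mul' (eLpNorm_gradient_le_of_energy_le (hw j) hβ0 hk0.le (hK j)) (le_of_eq (by norm_num))
    · intro x hx
      by_contra hxΩ
      refine hx (norm_eq_zero.1 ?_)
      rw [norm_gradient_eq_norm_fderiv, hsupg j x hxΩ, norm_zero]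
  obtain ⟨σ, hσ, hcau⟩ := exists_subseq_cauchy_of_gradient_bounded volume hΩb
    (fun j => (hw j).1.of_le (by simp)) (fun j => (hw j).2.1) (fun j => (hw j).2.2) hL2 hL1
  refine ⟨σ, hσ, exists_tendsto_eLpNorm_of_cauchy_one (f := fun j => w (σ j)) (by linarith) hs
    (fun j => (hw _).memLp _) (C := ((C * b : ENNReal) ^ (1 + k / 2)⁻¹).toNNReal)
    (fun j => ?_) fun ε hε => ?_⟩
  · rw [ENNReal.coe_toNNReal hCtop]
    exact hLs _
  · obtain ⟨N, hN⟩ := hcau ε hε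
    exact ⟨N, fun j hj l hl => (eLpNorm_mono_measure _ Measure.restrict_le_self).trans
      (hN j hj l hl)⟩

end Minimization

theorem tendsto_eLpNorm_linearCombination_sub {α F M : Type*} [MeasurableSpace α]
    [NormedAddCommGroup F] [NormedSpace ℝ F] [AddCommGroup M] [Module ℝ M] {μ : Measure α}
    {p : ENNReal} (hp : 1 ≤ p) (T : M →ₗ[ℝ] α → F) (hT : ∀ c, AEStronglyMeasurable (T c) μ)
    {v : α → F} (hv : AEStronglyMeasurable v μ) {e : ℕ → M}
    (he : Tendsto (fun j => eLpNorm (T (e j) - v) p μ) atTop (𝓝 0)) {c : ℕ → M}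
    (hc : ∀ m, c m ∈ convexHull ℝ (e '' Ici m)) :
    Tendsto (fun m => eLpNorm (T (c m) - v) p μ) atTop (𝓝 0) := by
  rw [ENNReal.tendsto_nhds_zero] at he ⊢
  intro ε hε
  obtain ⟨N, hN⟩ := eventually_atTop.1 (he ε hε)
  filter_upwards [eventually_ge_atTop N] with m hm
  refine convexHull_min ?_ (convex_setOf_eLpNorm_sub_le hp T hT hv ε) (hc m)
  rintro _ ⟨j, hj, rfl⟩
  exact hN j (hm.trans hj)

theorem exists_minimizing_sequence {n : ℕ} {Ω : Set (EuclideanSpace ℝ (Fin n))} (hn : 3 ≤ n)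
    {q : ℝ} (hq : q = 2 * n / (n - 2)) (hΩo : IsOpen Ω) (hΩb : Bornology.IsBounded Ω)
    (h0 : 0 ∈ Ω) {β k : ℝ} (hk0 : 0 < k) (hkq : k ≤ q) (hβ0 : 0 ≤ β) (hβ : β < k * n / q) :
    ∃ (v : ℕ → EuclideanSpace ℝ (Fin n) → ℝ) (u : EuclideanSpace ℝ (Fin n) → ℝ) (K : ℕ → ℝ),
      (∀ j, smoothCpt n Ω (v j)) ∧ (∀ x, 0 ≤ u x) ∧
      MemLp u (ENNReal.ofReal q) (volume.restrict Ω) ∧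
      eLpNorm u (ENNReal.ofReal q) (volume.restrict Ω) = 1 ∧
      Tendsto (fun j => eLpNorm (v j - u) (ENNReal.ofReal q) (volume.restrict Ω)) atTop (𝓝 0) ∧
      (∀ᵐ x ∂volume.restrict Ω, Tendsto (fun j => v j x) atTop (𝓝 (u x))) ∧
      Antitone K ∧ Tendsto K atTop (𝓝 (Sw n Ω β k q)) ∧ ∀ j, energy n Ω β k (v j) ≤ K j := by
  have hn' : (3 : ℝ) ≤ n := by exact_mod_cast hn
  have hq1 : 1 ≤ q := by
    rw [hq, le_div_iff₀ (by linarith)]; linarith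
  have hp1 : 1 ≤ ENNReal.ofReal q := by simpa using hq1
  choose w hw hw0 hwE hwle hwge using fun j : ℕ =>
    exists_nonneg_energy_le hΩo hΩb h0 hq1 hβ0 hk0.le (δ := 1 / ((j : ℝ) + 1)) (by positivity)
  obtain ⟨σ, hσ, u₀, hu₀, hconv⟩ := exists_subseq_tendsto_eLpNorm hn hq hΩb hk0 hkq hβ0 hβ hw
    hwle (K := Sw n Ω β k q + 1) (fun j => (hwE j).trans (by
      gcongr
      rw [div_le_one (by positivity)]
      simp))
  obtain ⟨ρ, hρ, hae⟩ := (tendstoInMeasure_of_tendsto_eLpNorm (by simpa using by linarith)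
    (fun j => ((hw (σ j)).memLp 1).1) hu₀.1 hconv).exists_seq_tendsto_ae
  have hτ : StrictMono (σ ∘ ρ) := hσ.comp hρ
  have hlim : Tendsto (fun j => eLpNorm (w (σ (ρ j)) - fun x => |u₀ x|) (ENNReal.ofReal q)
      (volume.restrict Ω)) atTop (𝓝 0) := by
    refine tendsto_of_tendsto_of_tendsto_of_le_of_le tendsto_const_nhds
      (hconv.comp hρ.tendsto_atTop) (fun j => zero_le) fun j => ?_
    refine eLpNorm_mono fun x => ?_
    simp only [Pi.sub_apply, Real.norm_eq_abs]
    nth_rewrite 1 [← abs_of_nonneg (hw0 (σ (ρ j)) x)]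
    exact abs_abs_sub_abs_le _ _
  have hδ : Tendsto (fun j => 1 / (((σ ∘ ρ) j : ℝ) + 1)) atTop (𝓝 0) :=
    tendsto_one_div_add_atTop_nhds_zero_nat.comp hτ.tendsto_atTop
  have habs := hu₀.norm
  simp only [Real.norm_eq_abs] at habs
  refine ⟨fun j => w (σ (ρ j)), fun x => |u₀ x|,
    fun j => Sw n Ω β k q + 1 / (((σ ∘ ρ) j : ℝ) + 1), fun j => hw _, fun x => abs_nonneg _,
    habs, le_antisymm ?_ ?_, hlim, ?_, ?_, ?_, fun j => hwE _⟩
  · have h1 := (tendsto_const_nhds (x := (1 : ENNReal))).add hlim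
    rw [add_zero] at h1
    refine ge_of_tendsto' h1 fun j => ?_
    have h2 := eLpNorm_sub_le (μ := volume.restrict Ω) ((hw (σ (ρ j))).memLp 1).1
      (((hw (σ (ρ j))).memLp 1).1.sub habs.1) hp1
    rw [sub_sub_cancel] at h2
    exact h2.trans (add_le_add (hwle _) le_rfl)
  · have h1 := (hlim.add_const (eLpNorm (fun x => |u₀ x|) (ENNReal.ofReal q)
      (volume.restrict Ω))).add (ENNReal.tendsto_ofReal hδ)
    rw [zero_add, ENNReal.ofReal_zero, add_zero] at h1
    refine ge_of_tendsto' h1 fun j => ?_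
    have h2 := eLpNorm_add_le (μ := volume.restrict Ω)
      (((hw (σ (ρ j))).memLp 1).1.sub habs.1) habs.1 hp1
    rw [sub_add_cancel] at h2
    exact (hwge (σ (ρ j))).trans (add_le_add h2 le_rfl)
  · filter_upwards [hae] with x hx
    refine hx.abs.congr fun j => abs_of_nonneg (hw0 _ x)
  · intro i j hij
    have : ((σ ∘ ρ) i : ℝ) ≤ (σ ∘ ρ) j := by exact_mod_cast hτ.monotone hij
    dsimp only
    gcongr
  · simpa using hδ.const_add (Sw n Ω β k q)

/-- Subcritical case `0 ≤ β < kn/q`: the infimum `S_Ω(β,k)` is attained by some nonnegative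
`u ∈ H_0^1(Ω)` (encoded by an approximating sequence `φ_j ∈ C_c^∞(Ω)` converging to `u` in
`L^q` whose gradients converge to `g` in `L²`). -/
theorem stmt_1 (n : ℕ) (hn : 3 ≤ n) (q : ℝ) (hq : q = 2 * n / (n - 2))
    (Ω : Set (EuclideanSpace ℝ (Fin n))) (hΩo : IsOpen Ω)
    (hΩb : Bornology.IsBounded Ω) (h0 : 0 ∈ Ω)
    (β k : ℝ) (hk0 : 0 < k) (hkq : k ≤ q) (hβ0 : 0 ≤ β) (hβ : β < k * n / q) :
    ∃ (u : EuclideanSpace ℝ (Fin n) → ℝ)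
      (g : EuclideanSpace ℝ (Fin n) → EuclideanSpace ℝ (Fin n))
      (φ : ℕ → EuclideanSpace ℝ (Fin n) → ℝ),
      (∀ x, 0 ≤ u x) ∧
      IntegrableOn (fun x => u x ^ q) Ω ∧
      (∫ x in Ω, u x ^ q) = 1 ∧
      IntegrableOn (fun x => ‖g x‖ ^ 2) Ω ∧
      (∀ j, smoothCpt n Ω (φ j)) ∧
      Tendsto (fun j => ∫ x in Ω, |φ j x - u x| ^ q) atTop (𝓝 0) ∧
      Tendsto (fun j => ∫ x in Ω, ‖gradient (φ j) x - g x‖ ^ 2) atTop (𝓝 0) ∧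
      (∫ x in Ω, (1 + ‖x‖ ^ β * u x ^ k) * ‖g x‖ ^ 2) = Sw n Ω β k q := by
  have hn' : (3 : ℝ) ≤ n := by exact_mod_cast hn
  have hq1 : 1 ≤ q := by
    rw [hq, le_div_iff₀ (by linarith)]; linarith
  have hqpos : 0 < q := by linarith
  have hp1 : 1 ≤ ENNReal.ofReal q := by simpa using hq1
  have hp0 : ENNReal.ofReal q ≠ 0 := (zero_lt_one.trans_le hp1).ne'
  obtain ⟨v, u, K, hv, hu0, hu, hunorm, hvu, hvae, hKanti, hKlim, hvK⟩ :=
    exists_minimizing_sequence hn hq hΩo hΩb h0 hk0 hkq hβ0 hβ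
  set V : ℕ → smoothCptSubmodule n Ω := fun j => ⟨v j, hv j⟩
  set C : ENNReal := ENNReal.ofReal (K 0) ^ (2⁻¹ : ℝ)
  have hC : C ≠ ⊤ := ENNReal.rpow_ne_top_of_nonneg (by norm_num) (by simp)
  obtain ⟨c, hc, G, hG⟩ := exists_tendsto_linearCombination_convexHull
    (gradientLp n Ω ∘ V) C.toReal (fun j => by
      change ‖MemLp.toLp (gradient (v j)) ((hv j).memLp_gradient 2)‖ ≤ _
      rw [Lp.norm_toLp]
      exact ENNReal.toReal_mono hC (eLpNorm_gradient_le_of_energy_le (hv j) hβ0 hk0.le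
        ((hvK j).trans (hKanti (Nat.zero_le j)))))
  set Φ : ℕ → smoothCptSubmodule n Ω := fun m => Finsupp.linearCombination ℝ V (c m)
  have hΦ : ∀ m, smoothCpt n Ω (Φ m : EuclideanSpace ℝ (Fin n) → ℝ) := fun m => (Φ m).2
  let g : EuclideanSpace ℝ (Fin n) → EuclideanSpace ℝ (Fin n) := ⇑G
  have hgmem : MemLp g 2 (volume.restrict Ω) := Lp.memLp G
  have hΦg : Tendsto (fun m => eLpNorm (gradient (Φ m : EuclideanSpace ℝ (Fin n) → ℝ) - g) 2
      (volume.restrict Ω)) atTop (𝓝 0) := by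
    refine (Lp.tendsto_Lp_iff_tendsto_eLpNorm''
      (fun m => gradient (Φ m : EuclideanSpace ℝ (Fin n) → ℝ))
      (fun m => (hΦ m).memLp_gradient 2) g hgmem).1 ?_
    rw [Lp.toLp_coeFn]
    refine hG.congr fun m => ?_
    rw [← Finsupp.apply_linearCombination]
    rfl
  have hΦu : Tendsto (fun m => eLpNorm ((Φ m : EuclideanSpace ℝ (Fin n) → ℝ) - u)
      (ENNReal.ofReal q) (volume.restrict Ω)) atTop (𝓝 0) := by
    refine tendsto_eLpNorm_linearCombination_sub hp1
      ((smoothCptSubmodule n Ω).subtype ∘ₗ Finsupp.linearCombination ℝ V)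
      (fun d => ((Finsupp.linearCombination ℝ V d).2.memLp 1).1) hu.1
      (e := fun j => Finsupp.single j 1) ?_ hc
    simpa [V] using hvu
  obtain ⟨τ₁, hτ₁, hae₁⟩ := (tendstoInMeasure_of_tendsto_eLpNorm two_ne_zero
    (fun m => ((hΦ m).memLp_gradient 1).1) hgmem.1 hΦg).exists_seq_tendsto_ae
  obtain ⟨τ₂, hτ₂, hae₂⟩ := (tendstoInMeasure_of_tendsto_eLpNorm hp0
    (fun m => ((hΦ (τ₁ m)).memLp 1).1) hu.1
    (hΦu.comp hτ₁.tendsto_atTop)).exists_seq_tendsto_ae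
  have hτ : StrictMono (τ₁ ∘ τ₂) := hτ₁.comp hτ₂
  have habsu : ∀ x, |u x| = u x := fun x => abs_of_nonneg (hu0 x)
  have huint := hu.integrable_norm_rpow hp0 (by simp)
  simp only [ENNReal.toReal_ofReal hqpos.le, Real.norm_eq_abs] at huint
  have hu1 : ∫ x in Ω, |u x| ^ q = 1 := by
    have h := ofReal_integral_norm_rpow hqpos hu
    rw [hunorm, ENNReal.one_rpow, ENNReal.ofReal_eq_one] at h
    simpa using h
  have hupper : ∫⁻ x in Ω, ENNReal.ofReal (1 + ‖x‖ ^ β * |u x| ^ k) * ‖g x‖ₑ ^ 2 ≤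
      ENNReal.ofReal (Sw n Ω β k q) := by
    refine lintegral_mul_enorm_sq_le_of_tendsto_convexHull
      (gradientLinearMap n Ω ∘ₗ Finsupp.linearCombination ℝ V)
      (fun d => ((Finsupp.linearCombination ℝ V d).2.memLp_gradient 1).1)
      (W := fun j x => ENNReal.ofReal (1 + ‖x‖ ^ β * |v j x| ^ k)) (fun j => ?_)
      (K := fun j => ENNReal.ofReal (K j))
      (fun i j hij => ENNReal.ofReal_le_ofReal (hKanti hij)) (ENNReal.tendsto_ofReal hKlim)
      (fun j => ?_) (c := fun m => c ((τ₁ ∘ τ₂) m))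
      (fun m => convexHull_mono (image_mono (Ici_subset_Ici.2 (hτ.id_le m))) (hc _)) ?_ ?_
      (fun x => by simp)
    · exact (((measurable_norm.pow_const β).mul
        ((hv j).1.continuous.measurable.abs.pow_const k)).const_add 1).ennreal_ofReal
    · have h := ENNReal.ofReal_le_ofReal (hvK j)
      rw [(hv j).ofReal_energy hβ0 hk0.le] at h
      simpa [V, gradientLinearMap] using h
    · filter_upwards [hae₁] with x hx
      exact hx.comp hτ₂.tendsto_atTop
    · filter_upwards [hvae] with x hx
      exact ENNReal.tendsto_ofReal (tendsto_const_nhds.add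
        (tendsto_const_nhds.mul (hx.abs.rpow_const (Or.inr hk0.le))))
  have hlower := ofReal_Sw_le_lintegral hΩo hΩb hqpos hβ0 hk0
    (φ := fun m => Φ ((τ₁ ∘ τ₂) m)) (fun m => hΦ _) hu hu1 hae₂ hgmem
    (hΦg.comp hτ.tendsto_atTop)
  refine ⟨u, g, fun m => Φ m, hu0, ?_, ?_, ?_, hΦ, ?_, ?_, ?_⟩
  · simpa only [habsu, IntegrableOn] using huint
  · simpa only [habsu] using hu1
  · exact hgmem.integrable_norm_pow two_ne_zero
  · simpa using tendsto_integral_norm_rpow_zero hqpos (fun m => ((hΦ m).memLp _).sub hu) hΦu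
  · have h2 : ENNReal.ofReal 2 = 2 := ENNReal.ofReal_ofNat 2
    simpa using tendsto_integral_norm_rpow_zero (q := 2) two_pos
      (fun m => by rw [h2]; exact ((hΦ m).memLp_gradient 2).sub hgmem) (by rwa [h2])
  · have hmeas : AEStronglyMeasurable (fun x => (1 + ‖x‖ ^ β * u x ^ k) * ‖g x‖ ^ 2)
        (volume.restrict Ω) :=
      ((((measurable_norm.pow_const β).aemeasurable.mul
        (hu.1.aemeasurable.pow_const k)).const_add 1).mul
        (hgmem.1.norm.aemeasurable.pow_const 2)).aestronglyMeasurable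
    rw [integral_eq_lintegral_of_nonneg_ae (Eventually.of_forall fun x => by
      have := hu0 x
      simp only [Pi.zero_apply]
      positivity) hmeas, ← ENNReal.toReal_ofReal (Sw_nonneg β k q), ← hupper.antisymm hlower]
    congr 1
    refine lintegral_congr fun x => ?_
    rw [habsu, ENNReal.ofReal_mul (by have := hu0 x; positivity),
      ENNReal.ofReal_pow (norm_nonneg _), ofReal_norm]

end
end

section
/- Suppose 0 ≤ k ≤ q and β > kn/q. Then S_Ω(β,k) = S. -/
open MeasureTheory Filter Topology Set

noncomputable section

theorem smoothCpt.continuous_gradient_s2 {n : ℕ} {Ω : Set (EuclideanSpace ℝ (Fin n))}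
    {u : EuclideanSpace ℝ (Fin n) → ℝ} (hu : smoothCpt n Ω u) : Continuous (gradient u) := by
  unfold gradient
  exact (LinearIsometryEquiv.continuous _).comp (hu.1.continuous_fderiv (by simp))

theorem gradient_eq_zero_of_notMem_tsupport {n : ℕ} {u : EuclideanSpace ℝ (Fin n) → ℝ}
    {x : EuclideanSpace ℝ (Fin n)} (hx : x ∉ tsupport u) : gradient u x = 0 := by
  have h : fderiv ℝ u x = 0 := by
    by_contra h
    exact hx (support_fderiv_subset ℝ (Function.mem_support.2 h))
  simp [gradient, h]

theorem smoothCpt.setIntegral_mul_gradient {n : ℕ} {Ω : Set (EuclideanSpace ℝ (Fin n))}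
    {u : EuclideanSpace ℝ (Fin n) → ℝ} (hu : smoothCpt n Ω u)
    (w : EuclideanSpace ℝ (Fin n) → ℝ) :
    ∫ x in Ω, w x * ‖gradient u x‖ ^ 2 = ∫ x, w x * ‖gradient u x‖ ^ 2 := by
  refine setIntegral_eq_integral_of_forall_compl_eq_zero fun x hx => ?_
  simp [gradient_eq_zero_of_notMem_tsupport fun h => hx (hu.2.2 h)]

theorem smoothCpt.setIntegral_abs_rpow {n : ℕ} {Ω : Set (EuclideanSpace ℝ (Fin n))}
    {u : EuclideanSpace ℝ (Fin n) → ℝ} (hu : smoothCpt n Ω u) {q : ℝ} (hq : q ≠ 0) :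
    ∫ x in Ω, |u x| ^ q = ∫ x, |u x| ^ q := by
  refine setIntegral_eq_integral_of_forall_compl_eq_zero fun x hx => ?_
  simp [image_eq_zero_of_notMem_tsupport fun h => hx (hu.2.2 h), hq]

theorem smoothCpt.integrable_mul_gradient {n : ℕ} {Ω : Set (EuclideanSpace ℝ (Fin n))}
    {u : EuclideanSpace ℝ (Fin n) → ℝ} (hu : smoothCpt n Ω u)
    {w : EuclideanSpace ℝ (Fin n) → ℝ} (hw : Continuous w) :
    Integrable fun x => w x * ‖gradient u x‖ ^ 2 := by
  refine (hw.mul (hu.continuous_gradient_s2.norm.pow 2)).integrable_of_hasCompactSupport ?_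
  refine HasCompactSupport.intro hu.2.1 fun x hx => ?_
  simp [gradient_eq_zero_of_notMem_tsupport hx]

theorem smoothCpt.continuous_weight {n : ℕ} {Ω : Set (EuclideanSpace ℝ (Fin n))}
    {u : EuclideanSpace ℝ (Fin n) → ℝ} (hu : smoothCpt n Ω u) {β k : ℝ} (hβ : 0 ≤ β)
    (hk : 0 ≤ k) : Continuous fun x => ‖x‖ ^ β * |u x| ^ k :=
  (continuous_norm.rpow_const fun _ => Or.inr hβ).mul
    (hu.1.continuous.abs.rpow_const fun _ => Or.inr hk)

/-- The weighted energy splits into the Dirichlet energy and the weighted part. -/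
theorem smoothCpt.energy_eq {n : ℕ} {Ω : Set (EuclideanSpace ℝ (Fin n))}
    {u : EuclideanSpace ℝ (Fin n) → ℝ} (hu : smoothCpt n Ω u) {β k : ℝ} (hβ : 0 ≤ β)
    (hk : 0 ≤ k) :
    energy n Ω β k u = (∫ x, ‖gradient u x‖ ^ 2) +
      ∫ x, ‖x‖ ^ β * |u x| ^ k * ‖gradient u x‖ ^ 2 := by
  have h1 := hu.integrable_mul_gradient (continuous_const (y := (1 : ℝ)))
  simp only [one_mul] at h1
  rw [energy, hu.setIntegral_mul_gradient fun x => 1 + ‖x‖ ^ β * |u x| ^ k,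
    ← integral_add h1 (hu.integrable_mul_gradient (hu.continuous_weight hβ hk))]
  simp only [add_mul, one_mul]

theorem smoothCpt.dirichlet_eq {n : ℕ} {Ω : Set (EuclideanSpace ℝ (Fin n))}
    {u : EuclideanSpace ℝ (Fin n) → ℝ} (hu : smoothCpt n Ω u) :
    ∫ x in Ω, ‖gradient u x‖ ^ 2 = ∫ x, ‖gradient u x‖ ^ 2 := by
  simpa using hu.setIntegral_mul_gradient fun _ => 1

theorem gradient_const_mul_comp_smul {n : ℕ} {u : EuclideanSpace ℝ (Fin n) → ℝ}
    (hu : Differentiable ℝ u) (c l : ℝ) (x : EuclideanSpace ℝ (Fin n)) :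
    gradient (fun y => c * u (l • y)) x = (c * l) • gradient u (l • x) := by
  have h : fderiv ℝ (fun y => c * u (l • y)) x = (c * l) • fderiv ℝ u (l • x) := by
    have h1 : HasFDerivAt (fun y : EuclideanSpace ℝ (Fin n) => l • y)
        (l • ContinuousLinearMap.id ℝ _) x := (hasFDerivAt_id x).const_smul l
    have h2 := ((hu (l • x)).hasFDerivAt.comp x h1).const_mul c
    refine h2.fderiv.trans ?_
    ext v
    simp [mul_assoc]
  simp [gradient, h]

/-- Concentrating a test function at the origin keeps it supported in `Ω`. -/
theorem smoothCpt.eventually_rescale {n : ℕ} {Ω : Set (EuclideanSpace ℝ (Fin n))}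
    (hΩ : Ω ∈ 𝓝 0) {u : EuclideanSpace ℝ (Fin n) → ℝ} (hu : smoothCpt n Ω u) (c : ℝ → ℝ) :
    ∀ᶠ l : ℝ in atTop, smoothCpt n Ω fun x => c l * u (l • x) := by
  obtain ⟨r, hr, hrΩ⟩ := Metric.mem_nhds_iff.1 hΩ
  obtain ⟨R, hR⟩ := hu.2.1.isBounded.subset_ball 0
  filter_upwards [eventually_gt_atTop 0, eventually_ge_atTop (R / r)] with l hl hlR
  refine ⟨contDiff_const.mul (hu.1.comp (contDiff_const_smul l)),
    (hu.2.1.comp_smul hl.ne').mul_left, fun x hx => hrΩ ?_⟩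
  have hx' : l • x ∈ tsupport u := by
    refine closure_minimal (t := (fun y => l • y) ⁻¹' tsupport u) (fun y hy => ?_)
      ((isClosed_tsupport u).preimage (continuous_const_smul l)) hx
    exact subset_tsupport u (right_ne_zero_of_mul hy)
  have h := hR hx'
  rw [mem_ball_zero_iff, norm_smul, Real.norm_of_nonneg hl.le] at h
  rw [div_le_iff₀ hr] at hlR
  rw [mem_ball_zero_iff]
  exact lt_of_mul_lt_mul_left (h.trans_le hlR) hl.le

theorem integral_rescale {n : ℕ} (f : EuclideanSpace ℝ (Fin n) → ℝ) {l : ℝ} (hl : 0 < l) :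
    ∫ x, l ^ (n : ℝ) * f (l • x) = ∫ x, f x := by
  rw [integral_const_mul, Measure.integral_comp_smul, finrank_euclideanSpace_fin,
    abs_of_nonneg (by positivity), Real.rpow_natCast, smul_eq_mul, ← mul_assoc,
    mul_inv_cancel₀ (by positivity), one_mul]

/-- Supercritical case `β > kn/q`: the weighted infimum coincides with the best Sobolev
constant, `S_Ω(β,k) = S`. -/
theorem stmt_2 (n : ℕ) (hn : 3 ≤ n) (q : ℝ) (hq : q = 2 * n / (n - 2))
    (Ω : Set (EuclideanSpace ℝ (Fin n))) (hΩo : IsOpen Ω)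
    (hΩb : Bornology.IsBounded Ω) (h0 : 0 ∈ Ω)
    (β k : ℝ) (hk0 : 0 ≤ k) (hkq : k ≤ q) (hβ : β > k * n / q) :
    Sw n Ω β k q = Sbest n Ω q := by
  have hn3 : (3 : ℝ) ≤ n := by exact_mod_cast hn
  have hn2 : (0 : ℝ) < n - 2 := by linarith
  have hq0 : 0 < q := by rw [hq]; exact div_pos (by linarith) hn2
  have hβ0 : 0 ≤ β := (by positivity : 0 ≤ k * n / q).trans hβ.le
  have hnn : ∀ u, 0 ≤ energy n Ω β k u := fun u =>
    integral_nonneg fun x => by dsimp only; positivity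
  by_cases hne : ∃ u, smoothCpt n Ω u ∧ (∫ x in Ω, |u x| ^ q) = 1
  swap
  · have h1 : ∀ f : (EuclideanSpace ℝ (Fin n) → ℝ) → ℝ,
        {c | ∃ u, smoothCpt n Ω u ∧ (∫ x in Ω, |u x| ^ q) = 1 ∧ c = f u} = ∅ := fun f =>
      Set.eq_empty_of_forall_notMem fun c ⟨u, hu, hu1, _⟩ => hne ⟨u, hu, hu1⟩
    rw [Sw, Sbest, h1, h1]
  obtain ⟨u₀, hu₀, hu₀1⟩ := hne
  apply le_antisymm
  · refine le_csInf ⟨_, u₀, hu₀, hu₀1, rfl⟩ ?_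
    rintro c ⟨u, hu, hu1, rfl⟩
    rw [hu.dirichlet_eq]
    have hs : 0 < β - k * n / q := sub_pos.2 hβ
    have hlim : Tendsto (fun l : ℝ => (∫ x, ‖gradient u x‖ ^ 2) + l ^ (-(β - k * n / q)) *
        ∫ x, ‖x‖ ^ β * |u x| ^ k * ‖gradient u x‖ ^ 2) atTop
        (𝓝 (∫ x, ‖gradient u x‖ ^ 2)) := by
      simpa using ((tendsto_rpow_neg_atTop hs).mul_const _).const_add _
    refine ge_of_tendsto hlim ?_
    filter_upwards [hu.eventually_rescale (hΩo.mem_nhds h0) (fun l => l ^ (n / q)),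
      eventually_gt_atTop 0] with l hv hl
    have hgrad : ∀ x, ‖gradient (fun y => l ^ (n / q) * u (l • y)) x‖ ^ 2 =
        l ^ (n : ℝ) * ‖gradient u (l • x)‖ ^ 2 := fun x => by
      rw [gradient_const_mul_comp_smul (hu.1.differentiable (by simp)), norm_smul, mul_pow,
        Real.norm_of_nonneg (by positivity)]
      congr 1
      rw [← Real.rpow_add_one hl.ne', ← Real.rpow_natCast, ← Real.rpow_mul hl.le]
      congr 1
      rw [hq]
      push_cast
      field_simp
      ring
    refine csInf_le ⟨0, ?_⟩ ⟨_, hv, ?_, ?_⟩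
    · rintro c ⟨w, -, -, rfl⟩
      exact hnn w
    · rw [hv.setIntegral_abs_rpow hq0.ne', ← hu1, hu.setIntegral_abs_rpow hq0.ne',
        ← integral_rescale (fun x => |u x| ^ q) hl]
      congr with x
      rw [abs_mul, abs_of_pos (by positivity), Real.mul_rpow (by positivity) (abs_nonneg _),
        ← Real.rpow_mul hl.le, div_mul_cancel₀ _ hq0.ne']
    · rw [hv.energy_eq hβ0 hk0]
      simp only [hgrad]
      congr 1
      · exact (integral_rescale (fun x => ‖gradient u x‖ ^ 2) hl).symm
      · rw [← integral_const_mul, ← integral_rescale _ hl]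
        congr with x
        have h1 : |l ^ (n / q) * u (l • x)| ^ k = l ^ (k * n / q) * |u (l • x)| ^ k := by
          rw [abs_mul, abs_of_pos (by positivity), Real.mul_rpow (by positivity) (abs_nonneg _),
            ← Real.rpow_mul hl.le]
          congr 2
          ring
        have h2 : ‖l • x‖ ^ β = l ^ β * ‖x‖ ^ β := by
          rw [norm_smul, Real.norm_of_nonneg hl.le, Real.mul_rpow hl.le (norm_nonneg _)]
        have h3 : l ^ (-(β - k * n / q)) * l ^ β = l ^ (k * n / q) := by
          rw [← Real.rpow_add hl]
          congr 1
          ring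
        rw [h1, h2, ← h3]
        ring
  · refine le_csInf ⟨_, u₀, hu₀, hu₀1, rfl⟩ ?_
    rintro c ⟨u, hu, hu1, rfl⟩
    have hle : Sbest n Ω q ≤ ∫ x in Ω, ‖gradient u x‖ ^ 2 := by
      refine csInf_le ⟨0, ?_⟩ ⟨u, hu, hu1, rfl⟩
      rintro c ⟨w, -, -, rfl⟩
      exact integral_nonneg fun x => by dsimp only; positivity
    refine hle.trans ?_
    rw [hu.dirichlet_eq, hu.energy_eq hβ0 hk0]
    exact le_add_of_nonneg_right (integral_nonneg fun x => by dsimp only; positivity)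

end
end
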